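/- arXiv:0910.0641 — 2 statements merged into one kernel-verified Lean document; each statement's English description precedes it below -/
import Mathlib

section
/- Let n ≥ k ≥ d+1 and let f : F₂ⁿ → F₂ have degree greater than d. Then Rej_{d,k}(f) ≥ 2^{k−n}. -/
open scoped Classical

noncomputable section

/-- `f : 𝔽₂ⁿ → 𝔽₂` has degree at most `d` (as a multilinear polynomial). -/
def degLE (n d : ℕ) (f : (Fin n → ZMod 2) → ZMod 2) : Prop :=
  ∃ p : MvPolynomial (Fin n) (ZMod 2), p.totalDegree ≤ d ∧ ∀ x, MvPolynomial.eval x p = f x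

/-- fractional Hamming distance between two functions on 𝔽₂ⁿ. -/
def hdist (n : ℕ) (f g : (Fin n → ZMod 2) → ZMod 2) : ℝ :=
  ((Finset.univ.filter fun x => f x ≠ g x).card : ℝ) / 2 ^ n

/-- distance of `f` to the Reed–Muller code RM(d,n). -/
def deltaD (n d : ℕ) (f : (Fin n → ZMod 2) → ZMod 2) : ℝ :=
  sInf {r : ℝ | ∃ g, degLE n d g ∧ r = hdist n f g}

/-- Rejection probability of the `k`-flat test: a uniformly random `k`-flat is chosen
(via a uniformly random injective affine parametrization `u ↦ M u + b`), and the test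
rejects iff the restriction of `f` does not have degree at most `d`. -/
def Rej (n d k : ℕ) (f : (Fin n → ZMod 2) → ZMod 2) : ℝ :=
  ((Finset.univ.filter fun Mb : Matrix (Fin n) (Fin k) (ZMod 2) × (Fin n → ZMod 2) =>
      Function.Injective Mb.1.mulVec ∧
        ¬ degLE k d (fun u => f (Mb.1.mulVec u + Mb.2))).card : ℝ) /
  ((Finset.univ.filter fun Mb : Matrix (Fin n) (Fin k) (ZMod 2) × (Fin n → ZMod 2) =>
      Function.Injective Mb.1.mulVec).card : ℝ)

/-- Rejection probability of the (d+1)-fold derivative (Gowers norm) test. -/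
def Rej0 (n d : ℕ) (f : (Fin n → ZMod 2) → ZMod 2) : ℝ :=
  ((Finset.univ.filter fun xa : (Fin n → ZMod 2) × (Fin (d+1) → Fin n → ZMod 2) =>
      (∑ S : Finset (Fin (d+1)), f (xa.1 + ∑ i ∈ S, xa.2 i)) = 1).card : ℝ) /
  ((2 ^ n) * (2 ^ n) ^ (d+1) : ℝ)

/-- the (d+1)-st Gowers norm of `f`. -/
def gowersNorm (n d : ℕ) (f : (Fin n → ZMod 2) → ZMod 2) : ℝ :=
  (1 - 2 * Rej0 n d f) ^ ((1 : ℝ) / 2 ^ (d+1))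

/-- t-fold XOR of `f`, as a function on 𝔽₂^(t·n). -/
def xorPow (n t : ℕ) (f : (Fin n → ZMod 2) → ZMod 2) :
    (Fin (t * n) → ZMod 2) → ZMod 2 :=
  fun x => ∑ i : Fin t, f fun j => x (finProdFinEquiv (i, j))

/-- elementary symmetric polynomial of degree m on n variables over 𝔽₂. -/
def symPoly (n m : ℕ) : (Fin n → ZMod 2) → ZMod 2 :=
  fun x => ∑ I ∈ Finset.powersetCard m Finset.univ, ∏ i ∈ I, x i

/-- the hyperplane `{x : L·x = b}`. -/
def hyp (n : ℕ) (L : Fin n → ZMod 2) (b : ZMod 2) : Set (Fin n → ZMod 2) :=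
  {x | ∑ i, L i * x i = b}


/-- The coefficient of `∏ i ∈ T, x i` in the multilinear representation of `f`, as the sum of
`f` over the indicator vectors of the subsets of `T`. -/
def mcoeff {n : ℕ} (f : (Fin n → ZMod 2) → ZMod 2) (T : Finset (Fin n)) : ZMod 2 :=
  ∑ U ∈ T.powerset, f fun i => if i ∈ U then 1 else 0

lemma mcoeff_add {n : ℕ} (f g : (Fin n → ZMod 2) → ZMod 2) (T : Finset (Fin n)) :
    mcoeff (fun x => f x + g x) T = mcoeff f T + mcoeff g T :=
  Finset.sum_add_distrib

lemma mcoeff_const_mul {n : ℕ} (c : ZMod 2) (f : (Fin n → ZMod 2) → ZMod 2)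
    (T : Finset (Fin n)) : mcoeff (fun x => c * f x) T = c * mcoeff f T :=
  (Finset.mul_sum _ _ _).symm

lemma mcoeff_sum {n : ℕ} {ι : Type*} (s : Finset ι) (f : ι → (Fin n → ZMod 2) → ZMod 2)
    (T : Finset (Fin n)) : mcoeff (fun x => ∑ j ∈ s, f j x) T = ∑ j ∈ s, mcoeff (f j) T :=
  Finset.sum_comm

lemma sum_powerset_sum_powerset {α : Type*} (V : Finset α) (F : Finset α → ZMod 2) :
    ∑ T ∈ V.powerset, ∑ U ∈ T.powerset, F U = F V := by
  induction V using Finset.induction_on generalizing F with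
  | empty => simp
  | insert a V ha ih =>
    rw [Finset.sum_powerset_insert ha, ← Finset.sum_add_distrib, ← ih fun U => F (insert a U)]
    refine Finset.sum_congr rfl fun T hT => ?_
    have haT : a ∉ T := fun h => ha (Finset.mem_powerset.1 hT h)
    rw [Finset.sum_powerset_insert haT, ← add_assoc, CharTwo.add_self_eq_zero, zero_add]

lemma eq_sum_mcoeff {n : ℕ} (f : (Fin n → ZMod 2) → ZMod 2) (x : Fin n → ZMod 2) :
    f x = ∑ T : Finset (Fin n), mcoeff f T * ∏ i ∈ T, x i := by
  have hx : x = fun i => if i ∈ Finset.univ.filter (fun i => x i = 1) then 1 else 0 := by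
    funext i
    have : ∀ a : ZMod 2, a = if a = 1 then 1 else 0 := by decide
    simpa using this (x i)
  generalize Finset.univ.filter (fun i => x i = 1) = V at hx
  subst hx
  rw [← sum_powerset_sum_powerset V fun U => f fun i => if i ∈ U then 1 else 0]
  rw [← Finset.sum_subset (Finset.subset_univ V.powerset)]
  · refine Finset.sum_congr rfl fun T hT => ?_
    rw [Finset.prod_eq_one, mul_one, mcoeff]
    intro i hi
    simp [Finset.mem_powerset.1 hT hi]
  · intro T _ hT
    obtain ⟨i, hi, hiV⟩ := Finset.not_subset.1 (mt Finset.mem_powerset.2 hT)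
    rw [Finset.prod_eq_zero hi (by simp [hiV]), mul_zero]

lemma mcoeff_monomial_eq_zero {n : ℕ} (m : Fin n →₀ ℕ) (T : Finset (Fin n))
    (h : (m.sum fun _ e => e) < T.card) :
    mcoeff (fun x => ∏ i, x i ^ m i) T = 0 := by
  obtain ⟨i, hiT, hi⟩ : ∃ i ∈ T, m i = 0 := by
    by_contra! hne
    have h1 : T.card ≤ ∑ i ∈ T, m i := by
      simpa using Finset.sum_le_sum fun i hi => Nat.one_le_iff_ne_zero.2 (hne i hi)
    have h2 : ∑ i ∈ T, m i ≤ ∑ i, m i := Finset.sum_le_univ_sum_of_nonneg fun _ => Nat.zero_le _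
    rw [Finsupp.sum_fintype _ _ fun _ => rfl] at h
    omega
  rw [mcoeff, ← Finset.insert_erase hiT, Finset.sum_powerset_insert (Finset.notMem_erase i T),
    ← Finset.sum_add_distrib]
  refine Finset.sum_eq_zero fun U _ => ?_
  refine (congrArg (_ + ·) ?_).trans (CharTwo.add_self_eq_zero _)
  refine Finset.prod_congr rfl fun j _ => ?_
  by_cases hj : j = i
  · simp [hj, hi]
  · simp [hj]

lemma degLE_iff_mcoeff {n d : ℕ} {f : (Fin n → ZMod 2) → ZMod 2} :
    degLE n d f ↔ ∀ T : Finset (Fin n), d < T.card → mcoeff f T = 0 := by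
  constructor
  · rintro ⟨p, hp, hpf⟩ T hT
    have hf : f = fun x => ∑ m ∈ p.support, p.coeff m * ∏ i, x i ^ m i := by
      funext x
      rw [← hpf, MvPolynomial.eval_eq']
    rw [hf, mcoeff_sum]
    refine Finset.sum_eq_zero fun m hm => ?_
    rw [mcoeff_const_mul, mcoeff_monomial_eq_zero, mul_zero]
    exact ((MvPolynomial.le_totalDegree hm).trans hp).trans_lt hT
  · intro h
    refine ⟨∑ T : Finset (Fin n), MvPolynomial.C (mcoeff f T) * ∏ i ∈ T, MvPolynomial.X i,
      MvPolynomial.totalDegree_finsetSum_le fun T _ => ?_, fun x => ?_⟩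
    · by_cases hT : d < T.card
      · simp [h T hT]
      · refine (MvPolynomial.totalDegree_mul _ _).trans ?_
        rw [MvPolynomial.totalDegree_C, zero_add]
        refine (MvPolynomial.totalDegree_finsetProd _ _).trans ?_
        simpa [MvPolynomial.totalDegree_X] using hT
    · simp [eq_sum_mcoeff f x, map_sum, map_prod]

lemma degLE.add {n d : ℕ} {f g : (Fin n → ZMod 2) → ZMod 2} (hf : degLE n d f)
    (hg : degLE n d g) : degLE n d fun x => f x + g x := by
  rw [degLE_iff_mcoeff] at *
  intro T hT
  rw [mcoeff_add, hf T hT, hg T hT, add_zero]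

lemma degLE.comp_affine {n m d : ℕ} {f : (Fin n → ZMod 2) → ZMod 2} (hf : degLE n d f)
    (M : Matrix (Fin n) (Fin m) (ZMod 2)) (b : Fin n → ZMod 2) :
    degLE m d fun u => f (M.mulVec u + b) := by
  obtain ⟨p, hp, hpf⟩ := hf
  let q : Fin n → MvPolynomial (Fin m) (ZMod 2) := fun i =>
    ∑ j, MvPolynomial.C (M i j) * MvPolynomial.X j + MvPolynomial.C (b i)
  have hq : ∀ i, (q i).totalDegree ≤ 1 := fun i => by
    refine (MvPolynomial.totalDegree_add _ _).trans (max_le ?_ (by simp))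
    refine MvPolynomial.totalDegree_finsetSum_le fun j _ => ?_
    refine (MvPolynomial.totalDegree_mul _ _).trans ?_
    simp [MvPolynomial.totalDegree_X]
  refine ⟨∑ e ∈ p.support, MvPolynomial.C (p.coeff e) * ∏ i, q i ^ e i,
    MvPolynomial.totalDegree_finsetSum_le fun e he => ?_, fun u => ?_⟩
  · refine (MvPolynomial.totalDegree_mul _ _).trans ?_
    rw [MvPolynomial.totalDegree_C, zero_add]
    refine ((MvPolynomial.totalDegree_finsetProd _ _).trans ?_).trans
      ((MvPolynomial.le_totalDegree he).trans hp)
    rw [Finsupp.sum_fintype _ _ fun _ => rfl]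
    refine Finset.sum_le_sum fun i _ => (MvPolynomial.totalDegree_pow _ _).trans ?_
    simpa using Nat.mul_le_mul_left (e i) (hq i)
  · simp only [← hpf (M.mulVec u + b), MvPolynomial.eval_eq' _ p]
    simp [q, map_sum, map_prod, Matrix.mulVec, dotProduct]

lemma mcoeff_coord_mul_insert {n : ℕ} (h : (Fin n → ZMod 2) → ZMod 2) {i : Fin n}
    {S : Finset (Fin n)} (hi : i ∉ S) :
    mcoeff (fun x => x i * h x) (insert i S) = mcoeff h (insert i S) + mcoeff h S := by
  simp only [mcoeff, Finset.sum_powerset_insert hi]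
  have h0 : ∑ U ∈ S.powerset, (if i ∈ U then (1 : ZMod 2) else 0) *
      h (fun j => if j ∈ U then 1 else 0) = 0 :=
    Finset.sum_eq_zero fun U hU => by
      simp [show i ∉ U from fun hU' => hi (Finset.mem_powerset.1 hU hU')]
  rw [h0]
  simp only [Finset.mem_insert_self, if_true, one_mul, zero_add]
  rw [add_right_comm, CharTwo.add_self_eq_zero, zero_add]

lemma mcoeff_coord_mul_of_notMem {n : ℕ} (h : (Fin n → ZMod 2) → ZMod 2) {i : Fin n}
    {S : Finset (Fin n)} (hi : i ∉ S) : mcoeff (fun x => x i * h x) S = 0 :=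
  Finset.sum_eq_zero fun U hU => by
    simp [show i ∉ U from fun hU' => hi (Finset.mem_powerset.1 hU hU')]

/-- Multiplying a function of degree less than `d` by an affine form gives degree at most `d`. -/
lemma degLE_affine_mul {n d : ℕ} {h : (Fin n → ZMod 2) → ZMod 2}
    (hh : ∀ T : Finset (Fin n), d ≤ T.card → mcoeff h T = 0) (L : Fin n → ZMod 2) (β : ZMod 2) :
    degLE n d fun u => (L ⬝ᵥ u + β) * h u := by
  rw [degLE_iff_mcoeff]
  intro T hT
  have : (fun u => (L ⬝ᵥ u + β) * h u) =
      fun u => (∑ i, L i * (u i * h u)) + β * h u := by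
    funext u
    simp only [dotProduct, add_mul, Finset.sum_mul, mul_assoc]
  rw [this, mcoeff_add, mcoeff_sum, mcoeff_const_mul, hh T hT.le, mul_zero, add_zero]
  refine Finset.sum_eq_zero fun i _ => ?_
  rw [mcoeff_const_mul]
  by_cases hi : i ∈ T
  · have hc := Finset.card_erase_add_one hi
    have := mcoeff_coord_mul_insert h (Finset.notMem_erase i T)
    rw [Finset.insert_erase hi] at this
    rw [this, hh T hT.le, hh _ (by omega), add_zero, mul_zero]
  · rw [mcoeff_coord_mul_of_notMem h hi, mul_zero]

/-- If `h` has degree at least `d` in more than `d` variables, some affine form raises its degree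
above `d`. -/
lemma exists_affine_mul_not_degLE {n d : ℕ} (hd : d < n) {h : (Fin n → ZMod 2) → ZMod 2}
    {S : Finset (Fin n)} (hS : d ≤ S.card) (hne : mcoeff h S ≠ 0) :
    ∃ (L : Fin n → ZMod 2) (β : ZMod 2), ¬ degLE n d fun u => (L ⬝ᵥ u + β) * h u := by
  by_contra! hall
  have hh : ∀ T : Finset (Fin n), d < T.card → mcoeff h T = 0 := by
    simpa [degLE_iff_mcoeff] using hall 0 1
  have hScard : S.card = d := le_antisymm (not_lt.1 fun hlt => hne (hh S hlt)) hS
  obtain ⟨i, hi⟩ : ∃ i, i ∉ S := by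
    by_contra! hS'
    rw [Finset.eq_univ_iff_forall.2 hS', Finset.card_fin] at hScard
    omega
  have hT : d < (insert i S).card := by rw [Finset.card_insert_of_notMem hi]; omega
  have h1 := degLE_iff_mcoeff.1 (hall (Pi.single i 1) 0) _ hT
  simp only [single_one_dotProduct, add_zero] at h1
  rw [mcoeff_coord_mul_insert h hi, hh _ hT, zero_add] at h1
  exact hne h1

/-- A function `g(u) + t h(u)` with `deg g ≤ d` and `deg h < d` has degree at most `d`. -/
lemma degLE_of_cons {k d : ℕ} {f : (Fin (k + 1) → ZMod 2) → ZMod 2}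
    {g h : (Fin k → ZMod 2) → ZMod 2} (hf : ∀ t u, f (Fin.cons t u) = g u + t * h u)
    (hg : degLE k d g) (hh : ∀ T : Finset (Fin k), d ≤ T.card → mcoeff h T = 0) :
    degLE (k + 1) d f := by
  obtain ⟨p, hp, hpg⟩ := hg
  refine ⟨MvPolynomial.rename Fin.succ p + ∑ T : Finset (Fin k),
    MvPolynomial.C (mcoeff h T) * (MvPolynomial.X 0 * ∏ i ∈ T, MvPolynomial.X i.succ), ?_,
    fun x => ?_⟩
  · refine (MvPolynomial.totalDegree_add _ _).trans
      (max_le ((MvPolynomial.totalDegree_rename_le _ _).trans hp) ?_)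
    refine MvPolynomial.totalDegree_finsetSum_le fun T _ => ?_
    by_cases hT : d ≤ T.card
    · simp [hh T hT]
    · refine (MvPolynomial.totalDegree_mul _ _).trans ?_
      rw [MvPolynomial.totalDegree_C, zero_add]
      refine (MvPolynomial.totalDegree_mul _ _).trans ?_
      have := MvPolynomial.totalDegree_finsetProd T
        fun i : Fin k => (MvPolynomial.X i.succ : MvPolynomial (Fin (k + 1)) (ZMod 2))
      simp only [MvPolynomial.totalDegree_X, Finset.sum_const, smul_eq_mul, mul_one] at this ⊢
      omega
  · have hx := hf (x 0) (Fin.tail x)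
    rw [Fin.cons_self_tail] at hx
    rw [hx, eq_sum_mcoeff h, ← hpg]
    simp only [map_add, map_sum, map_mul, map_prod, MvPolynomial.eval_C, MvPolynomial.eval_X,
      MvPolynomial.eval_rename, Finset.mul_sum, Fin.tail]
    congr 1
    exact Finset.sum_congr rfl fun T _ => by ring

/-- Among the hyperplanes `t = L ⬝ᵥ u + β`, at least half keep the degree of `f` above `d`. -/
lemma two_pow_le_card_not_degLE_graph {k d : ℕ} (hd : d < k)
    {f : (Fin (k + 1) → ZMod 2) → ZMod 2} (hf : ¬ degLE (k + 1) d f) :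
    2 ^ k ≤ (Finset.univ.filter fun Lβ : (Fin k → ZMod 2) × ZMod 2 =>
      ¬ degLE k d fun u => f (Fin.cons (Lβ.1 ⬝ᵥ u + Lβ.2) u)).card := by
  set g : (Fin k → ZMod 2) → ZMod 2 := fun u => f (Fin.cons 0 u) with hg
  set h : (Fin k → ZMod 2) → ZMod 2 := fun u => f (Fin.cons 0 u) + f (Fin.cons 1 u) with hh
  have hfgh : ∀ t u, f (Fin.cons t u) = g u + t * h u := by
    intro t u
    have : ∀ t a b : ZMod 2, (if t = 0 then a else b) = a + t * (a + b) := by decide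
    rw [hg, hh, ← this t]
    have ht : ∀ t : ZMod 2, t = 0 ∨ t = 1 := by decide
    rcases ht t with rfl | rfl <;> simp
  have hcard := Finset.card_filter_add_card_filter_not
    (s := (Finset.univ : Finset ((Fin k → ZMod 2) × ZMod 2)))
    (fun Lβ => degLE k d fun u => f (Fin.cons (Lβ.1 ⬝ᵥ u + Lβ.2) u))
  have htot : (Finset.univ : Finset ((Fin k → ZMod 2) × ZMod 2)).card = 2 * 2 ^ k := by
    simp [mul_comm]
  suffices hle : (Finset.univ.filter fun Lβ : (Fin k → ZMod 2) × ZMod 2 =>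
      degLE k d fun u => f (Fin.cons (Lβ.1 ⬝ᵥ u + Lβ.2) u)).card ≤
      (Finset.univ.filter fun Lβ : (Fin k → ZMod 2) × ZMod 2 =>
      ¬ degLE k d fun u => f (Fin.cons (Lβ.1 ⬝ᵥ u + Lβ.2) u)).card by omega
  by_cases hlow : ∀ T : Finset (Fin k), d ≤ T.card → mcoeff h T = 0
  · rw [Finset.filter_false_of_mem]
    · simp
    rintro ⟨L, β⟩ - hbad
    refine hf (degLE_of_cons hfgh ?_ hlow)
    convert hbad.add (degLE_affine_mul hlow L β) using 2 with u
    rw [hfgh, add_assoc, CharTwo.add_self_eq_zero, add_zero]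
  · push Not at hlow
    obtain ⟨S, hS, hne⟩ := hlow
    obtain ⟨L₀, β₀, h₀⟩ := exists_affine_mul_not_degLE hd hS hne
    refine Finset.card_le_card_of_injOn (fun Lβ => Lβ + (L₀, β₀)) ?_
      (add_left_injective _).injOn
    rintro ⟨L, β⟩ hL
    simp only [Finset.coe_filter, Finset.mem_univ, true_and, Set.mem_ofPred_eq] at hL ⊢
    intro hbad
    apply h₀
    convert hL.add hbad using 2 with u
    simp only [hfgh, Prod.mk_add_mk, add_dotProduct]
    linear_combination (-1 : ZMod 2) * CharTwo.add_self_eq_zero (g u + (L ⬝ᵥ u + β) * h u)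

/-- The affine parametrizations of `k`-flats. -/
def flatParams (n k : ℕ) : Finset (Matrix (Fin n) (Fin k) (ZMod 2) × (Fin n → ZMod 2)) :=
  Finset.univ.filter fun Mb => Function.Injective Mb.1.mulVec

/-- The affine parametrizations of `k`-flats on which `f` does not have degree at most `d`. -/
def rejParams (n d k : ℕ) (f : (Fin n → ZMod 2) → ZMod 2) :
    Finset (Matrix (Fin n) (Fin k) (ZMod 2) × (Fin n → ZMod 2)) :=
  Finset.univ.filter fun Mb => Function.Injective Mb.1.mulVec ∧
    ¬ degLE k d (fun u => f (Mb.1.mulVec u + Mb.2))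

lemma Rej_eq (n d k : ℕ) (f : (Fin n → ZMod 2) → ZMod 2) :
    Rej n d k f = ((rejParams n d k f).card : ℝ) / ((flatParams n k).card : ℝ) := rfl

/-- Prepending a column to a matrix. -/
def consColEquiv (n k : ℕ) :
    (Fin n → ZMod 2) × Matrix (Fin n) (Fin k) (ZMod 2) ≃
      Matrix (Fin n) (Fin (k + 1)) (ZMod 2) where
  toFun aM := Matrix.of fun i => Fin.cons (aM.1 i) (aM.2 i)
  invFun M := (fun i => M i 0, Matrix.of fun i j => M i j.succ)
  left_inv aM := by ext <;> simp
  right_inv M := by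
    ext i j
    refine Fin.cases ?_ (fun j => ?_) j <;> simp

lemma consColEquiv_mulVec {n k : ℕ} (a : Fin n → ZMod 2) (M : Matrix (Fin n) (Fin k) (ZMod 2))
    (t : ZMod 2) (u : Fin k → ZMod 2) :
    (consColEquiv n k (a, M)).mulVec (Fin.cons t u) = t • a + M.mulVec u := by
  ext i
  simp [consColEquiv, Matrix.mulVec, dotProduct, Fin.sum_univ_succ, mul_comm]

lemma consColEquiv_mulVec_injective {n k : ℕ} (a : Fin n → ZMod 2)
    (M : Matrix (Fin n) (Fin k) (ZMod 2)) :
    Function.Injective (consColEquiv n k (a, M)).mulVec ↔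
      Function.Injective M.mulVec ∧ a ∉ Set.range M.mulVec := by
  have key : ∀ {k : ℕ} (N : Matrix (Fin n) (Fin k) (ZMod 2)),
      Function.Injective N.mulVec ↔ ∀ u, N.mulVec u = 0 → u = 0 := fun N =>
    injective_iff_map_eq_zero N.mulVecLin
  have ht : ∀ t : ZMod 2, t = 0 ∨ t = 1 := by decide
  rw [key, key]
  constructor
  · refine fun h => ⟨fun u hu => ?_, ?_⟩
    · have := h (Fin.cons 0 u) (by rw [consColEquiv_mulVec, hu]; simp)
      funext i
      simpa using congrFun this i.succ
    · rintro ⟨u, hu⟩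
      have := h (Fin.cons 1 u) (by
        rw [consColEquiv_mulVec, hu, one_smul]
        exact funext fun i => CharTwo.add_self_eq_zero (a i))
      simpa using congrFun this 0
  · rintro ⟨h, ha⟩ v hv
    rw [← Fin.cons_self_tail v, consColEquiv_mulVec] at hv
    rcases ht (v 0) with h0 | h0
    · rw [h0, zero_smul, zero_add] at hv
      rw [← Fin.cons_self_tail v, h0, h _ hv]
      exact funext fun i => by refine Fin.cases ?_ (fun j => ?_) i <;> simp
    · refine absurd ⟨Fin.tail v, ?_⟩ ha
      rw [h0, one_smul, add_eq_zero_iff_eq_neg'] at hv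
      rw [hv]
      exact funext fun i => ZMod.neg_eq_self_mod_two (a i)

/-- The members `(M, b)` of a family `s` of `k`-flat parametrizations, each paired with a direction
outside the range of `M`. -/
def withDirection {n k : ℕ} (s : Finset (Matrix (Fin n) (Fin k) (ZMod 2) × (Fin n → ZMod 2))) :
    Finset ((Matrix (Fin n) (Fin k) (ZMod 2) × (Fin n → ZMod 2)) × (Fin n → ZMod 2)) :=
  Finset.univ.filter fun p => p.1 ∈ s ∧ p.2 ∉ Set.range p.1.1.mulVec

lemma card_withDirection {n k : ℕ}
    {s : Finset (Matrix (Fin n) (Fin k) (ZMod 2) × (Fin n → ZMod 2))}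
    (hs : s ⊆ flatParams n k) : (withDirection s).card = s.card * (2 ^ n - 2 ^ k) := by
  have : withDirection s =
      (s.sigma fun Mb => Finset.univ.filter fun a => a ∉ Set.range Mb.1.mulVec).map
        (Equiv.sigmaEquivProd _ _).toEmbedding := by
    ext ⟨Mb, a⟩
    simp [withDirection]
  rw [this, Finset.card_map, Finset.card_sigma, Finset.sum_const_nat]
  intro Mb hMb
  have hinj : Function.Injective Mb.1.mulVec := by simpa [flatParams] using hs hMb
  have h1 : (Finset.univ.filter fun a => a ∈ Set.range Mb.1.mulVec).card = 2 ^ k := by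
    have : (Finset.univ.filter fun a => a ∈ Set.range Mb.1.mulVec) =
        Finset.univ.image Mb.1.mulVec := by ext; simp
    rw [this, Finset.card_image_of_injective _ hinj]
    simp
  have h2 := Finset.card_filter_add_card_filter_not (s := (Finset.univ : Finset (Fin n → ZMod 2)))
    fun a => a ∈ Set.range Mb.1.mulVec
  have h3 : (Finset.univ : Finset (Fin n → ZMod 2)).card = 2 ^ n := by simp
  omega

/-- Regroup a `k`-flat parametrization and a direction as a `(k+1)`-column parametrization. -/
def extendEquiv (n k : ℕ) :
    (Matrix (Fin n) (Fin k) (ZMod 2) × (Fin n → ZMod 2)) × (Fin n → ZMod 2) ≃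
      Matrix (Fin n) (Fin (k + 1)) (ZMod 2) × (Fin n → ZMod 2) where
  toFun p := (consColEquiv n k (p.2, p.1.1), p.1.2)
  invFun q := ((((consColEquiv n k).symm q.1).2, q.2), ((consColEquiv n k).symm q.1).1)
  left_inv p := by simp
  right_inv q := by simp

lemma card_flatParams_succ (n k : ℕ) :
    (flatParams n (k + 1)).card = (flatParams n k).card * (2 ^ n - 2 ^ k) := by
  rw [← card_withDirection subset_rfl]
  refine (Finset.card_equiv (extendEquiv n k) fun p => ?_).symm
  simp only [withDirection, flatParams, Finset.mem_filter, Finset.mem_univ, true_and, extendEquiv,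
    Equiv.coe_fn_mk]
  exact (consColEquiv_mulVec_injective _ _).symm

/-- Pass from the flat `b + range M` to the graph of `L ⬝ᵥ u + β` over it in direction `a`. -/
def shear {n k : ℕ} (Lβ : (Fin k → ZMod 2) × ZMod 2) :
    Equiv.Perm ((Matrix (Fin n) (Fin k) (ZMod 2) × (Fin n → ZMod 2)) × (Fin n → ZMod 2)) :=
  Function.Involutive.toPerm
    (fun p => ((p.1.1 + Matrix.vecMulVec p.2 Lβ.1, p.1.2 + Lβ.2 • p.2), p.2)) fun p => by
      ext <;> simp [add_assoc, CharTwo.add_self_eq_zero]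

lemma shear_apply {n k : ℕ} (Lβ : (Fin k → ZMod 2) × ZMod 2)
    (p : (Matrix (Fin n) (Fin k) (ZMod 2) × (Fin n → ZMod 2)) × (Fin n → ZMod 2)) :
    shear Lβ p = ((p.1.1 + Matrix.vecMulVec p.2 Lβ.1, p.1.2 + Lβ.2 • p.2), p.2) := rfl

lemma extendEquiv_mulVec_graph {n k : ℕ} (L : Fin k → ZMod 2) (β : ZMod 2)
    (p : (Matrix (Fin n) (Fin k) (ZMod 2) × (Fin n → ZMod 2)) × (Fin n → ZMod 2))
    (u : Fin k → ZMod 2) :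
    (extendEquiv n k p).1.mulVec (Fin.cons (L ⬝ᵥ u + β) u) + (extendEquiv n k p).2 =
      (shear (L, β) p).1.1.mulVec u + (shear (L, β) p).1.2 := by
  simp only [extendEquiv, Equiv.coe_fn_mk, consColEquiv_mulVec, shear_apply, Matrix.add_mulVec,
    Matrix.vecMulVec_mulVec]
  ext i
  simp
  ring

lemma mem_withDirection_shear {n k : ℕ} (Lβ : (Fin k → ZMod 2) × ZMod 2)
    (p : (Matrix (Fin n) (Fin k) (ZMod 2) × (Fin n → ZMod 2)) × (Fin n → ZMod 2))
    (hp : p ∈ withDirection (flatParams n k)) :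
    shear Lβ p ∈ withDirection (flatParams n k) := by
  obtain ⟨⟨M, b⟩, a⟩ := p
  simp only [withDirection, flatParams, Finset.mem_filter, Finset.mem_univ, true_and,
    shear_apply, ← consColEquiv_mulVec_injective] at hp ⊢
  intro v w hvw
  rw [← Fin.cons_self_tail v, ← Fin.cons_self_tail w] at hvw ⊢
  have key : ∀ t u, (consColEquiv n k (a, M + Matrix.vecMulVec a Lβ.1)).mulVec (Fin.cons t u) =
      (consColEquiv n k (a, M)).mulVec (Fin.cons (t + Lβ.1 ⬝ᵥ u) u) := by
    intro t u
    simp only [consColEquiv_mulVec, Matrix.add_mulVec, Matrix.vecMulVec_mulVec]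
    ext i
    simp
    ring
  rw [key, key] at hvw
  obtain ⟨h0, htail⟩ := Fin.cons_inj.1 (hp hvw)
  rw [htail] at h0
  exact Fin.cons_inj.2 ⟨add_right_cancel h0, htail⟩

lemma card_rejParams_succ_le {n d k : ℕ} (hd : d < k)
    (f : (Fin n → ZMod 2) → ZMod 2) :
    (rejParams n d (k + 1) f).card ≤ 2 * ((rejParams n d k f).card * (2 ^ n - 2 ^ k)) := by
  have hsub : rejParams n d k f ⊆ flatParams n k := fun Mb h => by
    simp only [rejParams, flatParams, Finset.mem_filter] at h ⊢
    exact ⟨h.1, h.2.1⟩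
  rw [← card_withDirection hsub]
  have hdouble := Finset.sum_card_bipartiteAbove_eq_sum_card_bipartiteBelow
    (s := (rejParams n d (k + 1) f).map (extendEquiv n k).symm.toEmbedding)
    (t := (Finset.univ : Finset ((Fin k → ZMod 2) × ZMod 2)))
    fun p Lβ => shear Lβ p ∈ withDirection (rejParams n d k f)
  have hlow : ∀ p ∈ (rejParams n d (k + 1) f).map (extendEquiv n k).symm.toEmbedding,
      2 ^ k ≤ (Finset.bipartiteAbove
        (fun p Lβ => shear Lβ p ∈ withDirection (rejParams n d k f))
        (Finset.univ : Finset ((Fin k → ZMod 2) × ZMod 2)) p).card := by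
    intro p hp
    rw [Finset.mem_map_equiv, Equiv.symm_symm] at hp
    simp only [rejParams, Finset.mem_filter, Finset.mem_univ, true_and] at hp
    refine (two_pow_le_card_not_degLE_graph hd hp.2).trans (Finset.card_le_card ?_)
    rintro ⟨L, β⟩ hL
    simp only [Finset.mem_filter, Finset.mem_univ, true_and] at hL
    simp only [extendEquiv_mulVec_graph] at hL
    have hmem : p ∈ withDirection (flatParams n k) := by
      simp only [withDirection, flatParams, Finset.mem_filter, Finset.mem_univ, true_and]
      exact (consColEquiv_mulVec_injective _ _).1 hp.1
    have := mem_withDirection_shear (L, β) p hmem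
    simp only [withDirection, flatParams, Finset.mem_filter, Finset.mem_univ, true_and,
      Finset.bipartiteAbove, rejParams] at this ⊢
    exact ⟨⟨this.1, hL⟩, this.2⟩
  have hup : ∀ Lβ ∈ (Finset.univ : Finset ((Fin k → ZMod 2) × ZMod 2)),
      (Finset.bipartiteBelow
        (fun p Lβ => shear Lβ p ∈ withDirection (rejParams n d k f))
        ((rejParams n d (k + 1) f).map (extendEquiv n k).symm.toEmbedding) Lβ).card ≤
      (withDirection (rejParams n d k f)).card := fun Lβ _ =>
    Finset.card_le_card_of_injOn (shear Lβ) (fun p hp => (Finset.mem_filter.1 hp).2)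
      (shear Lβ).injective.injOn
  have h1 := Finset.card_nsmul_le_sum _ _ _ hlow
  have h2 := Finset.sum_le_card_nsmul _ _ _ hup
  rw [hdouble] at h1
  have h3 := h1.trans h2
  have htot : (Finset.univ : Finset ((Fin k → ZMod 2) × ZMod 2)).card = 2 * 2 ^ k := by
    simp [mul_comm]
  rw [Finset.card_map, htot, smul_eq_mul, smul_eq_mul] at h3
  have hpos : 0 < 2 ^ k := by positivity
  refine Nat.le_of_mul_le_mul_right (h3.trans_eq ?_) hpos
  ring

lemma Rej_succ_le {n d k : ℕ} (hd : d < k) (hkn : k < n) (f : (Fin n → ZMod 2) → ZMod 2) :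
    Rej n d (k + 1) f ≤ 2 * Rej n d k f := by
  have hpos : 0 < 2 ^ n - 2 ^ k := Nat.sub_pos_of_lt (Nat.pow_lt_pow_right one_lt_two hkn)
  have hpos' : (0 : ℝ) < ((2 ^ n - 2 ^ k : ℕ) : ℝ) := by exact_mod_cast hpos
  have h : ((rejParams n d (k + 1) f).card : ℝ) ≤
      2 * ((rejParams n d k f).card * ((2 ^ n - 2 ^ k : ℕ) : ℝ)) := by
    exact_mod_cast card_rejParams_succ_le hd f
  rw [Rej_eq, Rej_eq, card_flatParams_succ, Nat.cast_mul]
  calc _ ≤ 2 * ((rejParams n d k f).card * ((2 ^ n - 2 ^ k : ℕ) : ℝ)) /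
        ((flatParams n k).card * ((2 ^ n - 2 ^ k : ℕ) : ℝ)) := by gcongr
    _ = _ := by rw [mul_div_assoc, mul_div_mul_right _ _ hpos'.ne']

lemma Rej_self {n d : ℕ} {f : (Fin n → ZMod 2) → ZMod 2} (hf : ¬ degLE n d f) :
    Rej n d n f = 1 := by
  have heq : rejParams n d n f = flatParams n n := by
    refine Finset.filter_congr fun Mb _ => and_iff_left_of_imp fun hinj hdeg => hf ?_
    obtain ⟨M, b⟩ := Mb
    have hM : IsUnit M.det :=
      (Matrix.isUnit_iff_isUnit_det M).1 (Matrix.mulVec_injective_iff_isUnit.1 hinj)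
    convert hdeg.comp_affine M⁻¹ (-(M⁻¹.mulVec b)) using 2 with u
    simp [Matrix.mulVec_add, Matrix.mulVec_neg, Matrix.mul_nonsing_inv _ hM]
  have hne : (flatParams n n).card ≠ 0 := by
    refine Finset.card_ne_zero_of_mem (a := (1, 0)) ?_
    simp only [flatParams, Finset.mem_filter, Finset.mem_univ, true_and]
    intro u v huv
    simpa using huv
  rw [Rej_eq, heq, div_self (by exact_mod_cast hne)]

theorem statement11 (n d k : ℕ) (h1 : d + 1 ≤ k) (h2 : k ≤ n)
    (f : (Fin n → ZMod 2) → ZMod 2) (hf : ¬ degLE n d f) :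
    (2:ℝ) ^ ((k:ℤ) - n) ≤ Rej n d k f := by
  induction h2 using Nat.decreasingInduction with
  | self => simp [Rej_self hf]
  | of_succ k hkn ih =>
    have h := (ih (by omega)).trans (Rej_succ_le h1 hkn f)
    have hpow : (2 : ℝ) ^ (((k + 1 : ℕ) : ℤ) - n) = 2 * 2 ^ ((k : ℤ) - n) := by
      rw [← zpow_one_add₀ two_ne_zero]
      push_cast
      ring_nf
    rw [hpow] at h
    linarith

end
end

section
/- Let d+1 = 2^s for some integer s ≥ 2. Then for every ε > 0 there exists n₀ such that for every n ≥ n₀: (1) δ_d(S_{d+1,n}) ≥ 1/2 − ε, and (2) Rej_{d,d+1}(S_{d+1,n}) ≤ 1/2 − 2^{−7} + ε. -/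
open scoped Classical

noncomputable section

lemma sum_powerset_eq_sum_sdiff_union {α M : Type*} [DecidableEq α] [AddCommMonoid M]
    {T V : Finset α} (hT : T ⊆ V) (F : Finset α → M) :
    ∑ y ∈ V.powerset, F y = ∑ r ∈ (V \ T).powerset, ∑ y ∈ T.powerset, F (r ∪ y) := by
  rw [← Finset.sum_product']
  refine Finset.sum_nbij' (fun y => (y \ T, y ∩ T)) (fun p => p.1 ∪ p.2) ?_ ?_ ?_ ?_ ?_
  · intro y hy
    simp only [Finset.mem_powerset, Finset.mem_product] at hy ⊢
    exact ⟨Finset.sdiff_subset_sdiff hy le_rfl, Finset.inter_subset_right⟩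
  · rintro ⟨r, y⟩ hp
    simp only [Finset.mem_powerset, Finset.mem_product] at hp ⊢
    exact Finset.union_subset (hp.1.trans Finset.sdiff_subset) (hp.2.trans hT)
  · intro y _
    exact Finset.sdiff_union_inter y T
  · rintro ⟨r, y⟩ hp
    simp only [Finset.mem_powerset, Finset.mem_product] at hp
    ext a
    · have := @hp.1 a
      have := @hp.2 a
      simp only [Finset.mem_sdiff, Finset.mem_union] at *
      tauto
    · have := @hp.1 a
      have := @hp.2 a
      simp only [Finset.mem_sdiff, Finset.mem_union, Finset.mem_inter] at *
      tauto
  · intro y _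
    simp [Finset.sdiff_union_inter]

lemma card_union_of_subset_sdiff {α : Type*} [DecidableEq α] {T V r y : Finset α}
    (hr : r ⊆ V \ T) (hy : y ⊆ T) : (r ∪ y).card = r.card + y.card :=
  Finset.card_union_of_disjoint
    (Finset.disjoint_of_subset_left hr (Finset.disjoint_of_subset_right hy Finset.sdiff_disjoint))

/-- Two-colour Ramsey theorem for `k`-uniform hypergraphs. -/
theorem exists_ramsey_number (k : ℕ) : ∀ a b : ℕ, ∃ N : ℕ, ∀ (α : Type) [DecidableEq α]
    (V : Finset α), N ≤ V.card → ∀ c : Finset α → Prop,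
      (∃ T ⊆ V, T.card = a ∧ ∀ I ⊆ T, I.card = k → c I) ∨
      (∃ T ⊆ V, T.card = b ∧ ∀ I ⊆ T, I.card = k → ¬ c I) := by
  induction k with
  | zero =>
    intro a b
    refine ⟨max a b, fun α _ V hV c => ?_⟩
    by_cases h : c ∅
    · left
      obtain ⟨T, hT, hc⟩ := Finset.exists_subset_card_eq ((le_max_left a b).trans hV)
      exact ⟨T, hT, hc, fun I _ hI => by rwa [Finset.card_eq_zero.1 hI]⟩
    · right
      obtain ⟨T, hT, hc⟩ := Finset.exists_subset_card_eq ((le_max_right a b).trans hV)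
      exact ⟨T, hT, hc, fun I _ hI => by rwa [Finset.card_eq_zero.1 hI]⟩
  | succ k ih =>
    intro a
    induction a with
    | zero =>
      refine fun b => ⟨0, fun α _ V _ c => Or.inl ⟨∅, by simp, by simp, fun I hI hc => ?_⟩⟩
      simp [Finset.subset_empty.1 hI] at hc
    | succ a iha =>
      intro b
      induction b with
      | zero =>
        refine ⟨0, fun α _ V _ c => Or.inr ⟨∅, by simp, by simp, fun I hI hc => ?_⟩⟩
        simp [Finset.subset_empty.1 hI] at hc
      | succ b ihb =>
        obtain ⟨N₁, h₁⟩ := iha (b + 1)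
        obtain ⟨N₂, h₂⟩ := ihb
        obtain ⟨N, hN⟩ := ih N₁ N₂
        refine ⟨N + 1, fun α _ V hV c => ?_⟩
        obtain ⟨v, hv⟩ : V.Nonempty := Finset.card_pos.1 (by omega)
        have hext : ∀ (P : Finset α → Prop) (U T : Finset α), U ⊆ V.erase v → T ⊆ U →
            (∀ I ⊆ U, I.card = k → P (insert v I)) → (∀ I ⊆ T, I.card = k + 1 → P I) →
            insert v T ⊆ V ∧ (insert v T).card = T.card + 1 ∧
              ∀ I ⊆ insert v T, I.card = k + 1 → P I := by
          intro P U T hU hT hPU hPT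
          have hvT : v ∉ T := fun h => by simpa using hU (hT h)
          refine ⟨Finset.insert_subset hv ((hT.trans hU).trans (Finset.erase_subset _ _)),
            Finset.card_insert_of_notMem hvT, fun I hI hc => ?_⟩
          by_cases hvI : v ∈ I
          · rw [← Finset.insert_erase hvI]
            refine hPU _ (((Finset.subset_insert_iff).1 hI).trans hT) ?_
            rw [Finset.card_erase_of_mem hvI, hc]; rfl
          · exact hPT I ((Finset.subset_insert_iff_of_notMem hvI).1 hI) hc
        rcases hN α (V.erase v) (by rw [Finset.card_erase_of_mem hv]; omega)
          (fun I => c (insert v I)) with ⟨U, hU, hUc, hUI⟩ | ⟨U, hU, hUc, hUI⟩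
        · rcases h₁ α U hUc.ge c with ⟨T, hT, hTc, hTI⟩ | ⟨T, hT, hTc, hTI⟩
          · obtain ⟨x, y, z⟩ := hext c U T hU hT hUI hTI
            exact Or.inl ⟨_, x, by rw [y, hTc], z⟩
          · exact Or.inr ⟨T, (hT.trans hU).trans (Finset.erase_subset _ _), hTc, hTI⟩
        · rcases h₂ α U hUc.ge c with ⟨T, hT, hTc, hTI⟩ | ⟨T, hT, hTc, hTI⟩
          · exact Or.inl ⟨T, (hT.trans hU).trans (Finset.erase_subset _ _), hTc, hTI⟩
          · obtain ⟨x, y, z⟩ := hext (fun I => ¬ c I) U T hU hT hUI hTI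
            exact Or.inr ⟨_, x, by rw [y, hTc], z⟩

lemma abs_sum_powerset_le_of_antiperiodic {K : ℕ} (hK : 0 < K) {α : Type} [DecidableEq α] (t : ℕ) :
    ∀ (V : Finset α), K * t ≤ V.card → ∀ (B : ℝ) (h : ℕ → ℝ), (∀ m, |h m| ≤ B) →
      (∀ m, h (m + K) = - h m) →
      |∑ y ∈ V.powerset, h y.card| ≤ B * (1 - 2 / 2 ^ K) ^ t * 2 ^ V.card := by
  induction t with
  | zero =>
    intro V _ B h hB _
    refine (Finset.abs_sum_le_sum_abs _ _).trans ((Finset.sum_le_sum fun y _ => hB _).trans ?_)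
    simp [mul_comm]
  | succ t ih =>
    intro V hV B h hB hK'
    obtain ⟨U, hU, hUc⟩ := Finset.exists_subset_card_eq (s := V) (n := K) (by nlinarith)
    have hUne : U ≠ ∅ := fun h0 => by simp [h0] at hUc; omega
    have hcard : (V \ U).card + K = V.card := by
      rw [← hUc]; exact Finset.card_sdiff_add_card_eq_card hU
    have h2 : (2 : ℝ) ^ K ≠ 0 := by positivity
    have key : ∀ m, |∑ z ∈ U.powerset, h (m + z.card)| ≤ B * (2 ^ K - 2) := by
      intro m
      rw [← Finset.add_sum_erase _ _ (Finset.empty_mem_powerset U),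
        ← Finset.add_sum_erase (a := U) _ _ (by simp [hUne]), hUc, hK', Finset.card_empty,
        add_zero, add_neg_cancel_left]
      refine (Finset.abs_sum_le_sum_abs _ _).trans ((Finset.sum_le_sum fun y _ => hB _).trans ?_)
      rw [Finset.sum_const, Finset.card_erase_of_mem (by simp [hUne]),
        Finset.card_erase_of_mem (by simp), Finset.card_powerset, hUc, nsmul_eq_mul]
      have : 2 ^ 1 ≤ 2 ^ K := Nat.pow_le_pow_right (by norm_num) hK
      rw [Nat.sub_sub, Nat.cast_sub (by omega)]
      push_cast
      linarith
    have := ih (V \ U) (by rw [mul_add] at hV; omega) (B * (1 - 2 / 2 ^ K))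
      (fun m => (∑ z ∈ U.powerset, h (m + z.card)) / 2 ^ K)
      (fun m => by
        rw [abs_div, abs_of_pos (show (0 : ℝ) < 2 ^ K by positivity), div_le_iff₀ (by positivity)]
        refine (key m).trans (le_of_eq ?_)
        field_simp)
      (fun m => by
        rw [← neg_div, ← Finset.sum_neg_distrib]
        congr 1
        refine Finset.sum_congr rfl fun z _ => ?_
        rw [← hK']; congr 1; omega)
    rw [← Finset.sum_div, abs_div, abs_of_pos (show (0 : ℝ) < 2 ^ K by positivity),
      div_le_iff₀ (by positivity)] at this
    rw [sum_powerset_eq_sum_sdiff_union hU]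
    calc _ = |∑ y ∈ (V \ U).powerset, ∑ z ∈ U.powerset, h (y.card + z.card)| := by
          congr 1
          refine Finset.sum_congr rfl fun r hr => Finset.sum_congr rfl fun y hy => ?_
          rw [card_union_of_subset_sdiff (Finset.mem_powerset.1 hr) (Finset.mem_powerset.1 hy)]
      _ ≤ _ := this
      _ = _ := by rw [← hcard]; ring

lemma natCast_choose_add_two_pow (s m k : ℕ) (hk : k ≤ 2 ^ s) :
    (((m + 2 ^ s).choose k : ℕ) : ZMod 2) = (m.choose k : ZMod 2) + if k = 2 ^ s then 1 else 0 := by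
  rw [Nat.add_choose_eq, Nat.cast_sum, ← Finset.add_sum_erase (a := (k, 0)) _ _ (by simp)]
  congr 1
  · simp
  split_ifs with h
  · rw [Finset.sum_eq_single (0, k)]
    · simp [h]
    · rintro ⟨i, j⟩ hij hne
      have hs := Finset.HasAntidiagonal.mem_antidiagonal.1 (Finset.mem_of_mem_erase hij)
      simp only [Finset.mem_erase, ne_eq, Prod.mk.injEq] at hij hne hs
      rw [ZMod.natCast_eq_zero_iff]
      exact (Nat.prime_two.dvd_choose_pow (by omega) (by omega)).mul_left _
    · intro h0
      have : 2 ^ s ≠ 0 := by positivity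
      simp_all
  · refine Finset.sum_eq_zero ?_
    rintro ⟨i, j⟩ hij
    have hs := Finset.HasAntidiagonal.mem_antidiagonal.1 (Finset.mem_of_mem_erase hij)
    simp only [Finset.mem_erase, ne_eq, Prod.mk.injEq] at hij hs
    rw [ZMod.natCast_eq_zero_iff]
    exact (Nat.prime_two.dvd_choose_pow (by omega) (by omega)).mul_left _

/-- The character `a ↦ (-1)^a` of `𝔽₂`, as a real number. -/
def signChar (a : ZMod 2) : ℝ := if a = 0 then 1 else -1

lemma ZMod.eq_zero_or_eq_one_of_two (a : ZMod 2) : a = 0 ∨ a = 1 := by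
  revert a; decide

lemma signChar_add (a b : ZMod 2) : signChar (a + b) = signChar a * signChar b := by
  rcases ZMod.eq_zero_or_eq_one_of_two a with rfl | rfl <;>
  rcases ZMod.eq_zero_or_eq_one_of_two b with rfl | rfl <;>
  simp [signChar, show (1 + 1 : ZMod 2) = 0 from rfl]

lemma abs_signChar (a : ZMod 2) : |signChar a| = 1 := by
  unfold signChar; split_ifs <;> simp

theorem exists_abs_sum_antiperiodic_mul_signChar_le (s k : ℕ) (hk : k ≤ 2 ^ s) :
    ∀ ε : ℝ, 0 < ε → ∃ N : ℕ, ∀ (α : Type) [DecidableEq α] (V : Finset α), N ≤ V.card →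
      ∀ h : ℕ → ℝ, (∀ m, |h m| ≤ 1) → (∀ m, h (m + 2 ^ s) = - h m) →
      ∀ a : Finset α → ZMod 2, (∀ I, k ≤ I.card → a I = 0) →
      |∑ y ∈ V.powerset, h y.card * signChar (∑ I ∈ y.powerset, a I)| ≤ ε * 2 ^ V.card := by
  induction k with
  | zero =>
    intro ε hε
    have h1 : (1 : ℝ) - 2 / 2 ^ (2 ^ s) < 1 := by
      have : (0 : ℝ) < 2 / 2 ^ (2 ^ s) := by positivity
      linarith
    obtain ⟨t, ht⟩ := exists_pow_lt_of_lt_one hε h1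
    refine ⟨2 ^ s * t, fun α _ V hV h hb hp a ha => ?_⟩
    have : ∀ y : Finset α, ∑ I ∈ y.powerset, a I = 0 :=
      fun y => Finset.sum_eq_zero fun I _ => ha I (Nat.zero_le _)
    simp only [this]
    simp only [signChar, if_true, mul_one]
    refine (abs_sum_powerset_le_of_antiperiodic (by positivity) t V hV 1 h hb hp).trans ?_
    rw [one_mul]
    gcongr
  | succ k ih =>
    intro ε hε
    obtain ⟨N, hN⟩ := ih (by omega) ε hε
    obtain ⟨R, hR⟩ := exists_ramsey_number k N N
    refine ⟨R, fun α _ V hV h hb hp a ha => ?_⟩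
    obtain ⟨T, hTV, hTc, b, hTb⟩ : ∃ T ⊆ V, T.card = N ∧ ∃ b, ∀ I ⊆ T, I.card = k → a I = b := by
      rcases hR α V hV (fun I => a I = 0) with ⟨T, hT, hTc, hTI⟩ | ⟨T, hT, hTc, hTI⟩
      · exact ⟨T, hT, hTc, 0, hTI⟩
      · exact ⟨T, hT, hTc, 1, fun I hI hc =>
          (ZMod.eq_zero_or_eq_one_of_two _).resolve_left (hTI I hI hc)⟩
    have inner : ∀ r ∈ (V \ T).powerset, |∑ y ∈ T.powerset,
        h (r ∪ y).card * signChar (∑ I ∈ (r ∪ y).powerset, a I)| ≤ ε * 2 ^ T.card := by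
      intro r hr
      rw [Finset.mem_powerset] at hr
      have hrT : ∀ y ⊆ T, ∀ J ⊆ r, ∀ I ⊆ y, (J ∪ I).card = J.card + I.card :=
        fun y hy J hJ I hI => card_union_of_subset_sdiff (hJ.trans hr) (hI.trans hy)
      have := hN α T hTc.ge
        (fun m => h (r.card + m) * signChar (b * (m.choose k : ℕ)))
        (fun m => by rw [abs_mul, abs_signChar, mul_one]; exact hb _)
        (fun m => by
          rw [natCast_choose_add_two_pow s m k (by omega), if_neg (by omega), add_zero,
            ← add_assoc, hp, neg_mul])
        (fun I => if I.card < k then ∑ J ∈ r.powerset, a (J ∪ I) else 0)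
        (fun I hI => if_neg (by omega))
      refine le_trans (le_of_eq ?_) this
      congr 1
      refine Finset.sum_congr rfl fun y hy => ?_
      rw [Finset.mem_powerset] at hy
      rw [hrT y hy r le_rfl y le_rfl, mul_assoc, ← signChar_add]
      congr 2
      have hsplit := sum_powerset_eq_sum_sdiff_union (T := y) (V := r ∪ y)
        Finset.subset_union_right a
      have hsd : (r ∪ y) \ y = r := by
        rw [Finset.union_sdiff_right, Finset.sdiff_eq_self_iff_disjoint]
        exact Finset.disjoint_of_subset_left hr
          (Finset.disjoint_of_subset_right hy Finset.sdiff_disjoint)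
      rw [hsplit, hsd, Finset.sum_comm]
      have hch : (b * (y.card.choose k : ℕ) : ZMod 2)
          = ∑ I ∈ y.powerset, if I.card = k then b else 0 := by
        rw [← Finset.sum_filter, Finset.sum_const, ← Finset.powersetCard_eq_filter,
          Finset.card_powersetCard, nsmul_eq_mul, mul_comm]
      rw [hch, ← Finset.sum_add_distrib]
      refine Finset.sum_congr rfl fun I hI => ?_
      rw [Finset.mem_powerset] at hI
      rcases lt_trichotomy I.card k with hlt | heq | hgt
      · rw [if_neg hlt.ne, if_pos hlt, zero_add]
      · rw [if_pos heq, if_neg (by omega), add_zero, Finset.sum_eq_single ∅]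
        · rw [Finset.empty_union]; exact hTb I (hI.trans hy) heq
        · intro J hJ hne
          rw [Finset.mem_powerset] at hJ
          have := Finset.card_pos.2 (Finset.nonempty_iff_ne_empty.2 hne)
          exact ha _ (by rw [hrT y hy J hJ I hI]; omega)
        · simp
      · rw [if_neg (by omega), if_neg (by omega), add_zero]
        refine Finset.sum_eq_zero fun J hJ => ha _ ?_
        rw [Finset.mem_powerset] at hJ
        rw [hrT y hy J hJ I hI]; omega
    rw [sum_powerset_eq_sum_sdiff_union hTV]
    refine (Finset.abs_sum_le_sum_abs _ _).trans ((Finset.sum_le_sum inner).trans (le_of_eq ?_))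
    rw [Finset.sum_const, Finset.card_powerset, nsmul_eq_mul,
      ← Finset.card_sdiff_add_card_eq_card hTV, pow_add]
    push_cast
    ring

lemma sum_eq_sum_powerset_indicator {n : ℕ} (Φ : (Fin n → ZMod 2) → ℝ) :
    ∑ x, Φ x = ∑ y ∈ (Finset.univ : Finset (Fin n)).powerset, Φ fun i => if i ∈ y then 1 else 0 := by
  refine Finset.sum_nbij' (fun x => Finset.univ.filter fun i => x i = 1)
    (fun y i => if i ∈ y then 1 else 0) ?_ ?_ ?_ ?_ ?_
  · simp
  · simp
  · intro x _
    funext i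
    rcases ZMod.eq_zero_or_eq_one_of_two (x i) with h | h <;> simp [h]
  · intro y _
    ext i
    simp
  · intro x _
    congr 1
    funext i
    rcases ZMod.eq_zero_or_eq_one_of_two (x i) with h | h <;> simp [h]

lemma symPoly_indicator (n m : ℕ) (y : Finset (Fin n)) :
    symPoly n m (fun i => if i ∈ y then 1 else 0) = (y.card.choose m : ℕ) := by
  have h : ∀ I : Finset (Fin n), (∏ i ∈ I, if i ∈ y then (1 : ZMod 2) else 0) =
      if I ⊆ y then 1 else 0 := fun I => by
    rw [Finset.prod_ite_zero]; simp [Finset.subset_iff]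
  simp only [symPoly, h]
  rw [← Finset.sum_filter, Finset.sum_const, nsmul_one, ← Finset.card_powersetCard]
  congr 2
  ext I
  simp [Finset.mem_powersetCard, and_comm]

lemma degLE.exists_sum_powerset {n d : ℕ} {g : (Fin n → ZMod 2) → ZMod 2} (hg : degLE n d g) :
    ∃ a : Finset (Fin n) → ZMod 2, (∀ I, d < I.card → a I = 0) ∧
      ∀ y : Finset (Fin n), g (fun i => if i ∈ y then 1 else 0) = ∑ I ∈ y.powerset, a I := by
  obtain ⟨p, hp, hpg⟩ := hg
  refine ⟨fun I => ∑ m ∈ p.support with m.support = I, p.coeff m, fun I hI => ?_, fun y => ?_⟩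
  · refine Finset.sum_eq_zero fun m hm => ?_
    rw [Finset.mem_filter] at hm
    exfalso
    have h1 := (MvPolynomial.le_totalDegree hm.1).trans hp
    have h2 : m.support.card ≤ m.sum fun _ e => e := by
      rw [Finset.card_eq_sum_ones, Finsupp.sum]
      exact Finset.sum_le_sum fun i hi => Nat.one_le_iff_ne_zero.2 (Finsupp.mem_support_iff.1 hi)
    rw [hm.2] at h2
    omega
  · rw [← hpg, MvPolynomial.eval_eq]
    have h : ∀ m : Fin n →₀ ℕ, (∏ i ∈ m.support, (if i ∈ y then (1 : ZMod 2) else 0) ^ m i) =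
        if m.support ⊆ y then 1 else 0 := fun m => by
      rw [Finset.prod_congr rfl (g := fun i => if i ∈ y then (1 : ZMod 2) else 0) fun i hi => ?_]
      · rw [Finset.prod_ite_zero]; simp [Finset.subset_iff]
      · rw [ite_pow, one_pow, zero_pow (Finsupp.mem_support_iff.1 hi)]
    simp only [h, mul_ite, mul_one, mul_zero]
    rw [← Finset.sum_filter]
    rw [← Finset.sum_fiberwise_of_maps_to (t := y.powerset) (g := fun m => m.support)]
    · refine Finset.sum_congr rfl fun I hI => ?_
      rw [Finset.mem_powerset] at hI
      refine Finset.sum_congr ?_ fun _ _ => rfl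
      ext m
      simp only [Finset.mem_filter]
      constructor
      · tauto
      · rintro ⟨h1, rfl⟩
        exact ⟨⟨h1, hI⟩, rfl⟩
    · intro m hm
      simpa using (Finset.mem_filter.1 hm).2

lemma hdist_eq_sum_signChar (n : ℕ) (f g : (Fin n → ZMod 2) → ZMod 2) :
    hdist n f g = 1 / 2 - (∑ x, signChar (f x + g x)) / 2 / 2 ^ n := by
  have h : ∀ x, signChar (f x + g x) = 1 - 2 * if f x ≠ g x then (1 : ℝ) else 0 := fun x => by
    unfold signChar
    rcases ZMod.eq_zero_or_eq_one_of_two (f x) with h1 | h1 <;>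
    rcases ZMod.eq_zero_or_eq_one_of_two (g x) with h2 | h2 <;>
    norm_num [h1, h2, show (1 + 1 : ZMod 2) = 0 from rfl]
  simp only [h, Finset.sum_sub_distrib, ← Finset.mul_sum, Finset.sum_boole, hdist]
  simp
  field_simp
  ring

theorem exists_forall_le_deltaD_symPoly (s d : ℕ) (hd : d + 1 = 2 ^ s) (ε : ℝ) (hε : 0 < ε) :
    ∃ n₀ : ℕ, ∀ n, n₀ ≤ n → 1 / 2 - ε ≤ deltaD n d (symPoly n (d + 1)) := by
  obtain ⟨N, hN⟩ := exists_abs_sum_antiperiodic_mul_signChar_le s (2 ^ s) le_rfl ε hε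
  refine ⟨N, fun n hn => le_csInf ⟨_, 0, ⟨0, by simp, by simp⟩, rfl⟩ ?_⟩
  rintro _ ⟨g, hg, rfl⟩
  obtain ⟨a, ha, hga⟩ := hg.exists_sum_powerset
  have := hN (Fin n) Finset.univ (by simpa) (fun m => signChar (m.choose (2 ^ s) : ℕ))
    (fun m => (abs_signChar _).le)
    (fun m => by
      rw [natCast_choose_add_two_pow s m _ le_rfl, if_pos rfl, signChar_add]
      simp [signChar])
    a (fun I hI => ha I (by omega))
  rw [hdist_eq_sum_signChar, sum_eq_sum_powerset_indicator]
  simp only [symPoly_indicator, hga, hd, signChar_add]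
  simp only [Finset.card_univ, Fintype.card_fin] at this
  have h2 : (0 : ℝ) < 2 ^ n := by positivity
  have h3 := (abs_le.1 this).2
  rw [div_div, sub_le_sub_iff_left, div_le_iff₀ (by positivity)]
  nlinarith

lemma sum_prod_mulVec_add_eq_det {D : ℕ} (A : Matrix (Fin D) (Fin D) (ZMod 2))
    (b : Fin D → ZMod 2) : ∑ u, ∏ i, (A.mulVec u + b) i = A.det := by
  rcases ZMod.eq_zero_or_eq_one_of_two A.det with h | h
  · rw [h]
    obtain ⟨w, hw, hAw⟩ := Matrix.exists_mulVec_eq_zero_iff.2 h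
    refine Finset.sum_involution (fun u _ => u + w) (fun u _ => ?_) (fun u _ _ => ?_)
      (fun _ _ => Finset.mem_univ _) (fun u _ => ?_)
    · rw [Matrix.mulVec_add, hAw, add_zero]; exact CharTwo.add_self_eq_zero _
    · simpa using hw
    · funext i; simp [add_assoc, CharTwo.add_self_eq_zero]
  · rw [h]
    have hu : IsUnit A.det := by rw [h]; exact isUnit_one
    have key : ∀ z : Fin D → ZMod 2, ∏ i, z i = if z = 1 then 1 else 0 := fun z => by
      split_ifs with hz
      · simp [hz]
      · obtain ⟨i, hi⟩ := Function.ne_iff.1 hz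
        exact Finset.prod_eq_zero (Finset.mem_univ i)
          ((ZMod.eq_zero_or_eq_one_of_two _).resolve_right hi)
    simp only [key]
    rw [Finset.sum_eq_single (A⁻¹.mulVec (1 - b))]
    · simp [Matrix.mulVec_mulVec, Matrix.mul_nonsing_inv _ hu]
    · intro u _ hne
      rw [if_neg]
      intro he
      apply hne
      rw [← he, add_sub_cancel_right, Matrix.mulVec_mulVec, Matrix.nonsing_inv_mul _ hu,
        Matrix.one_mulVec]
    · simp

/-- The sum of the principal minors of order `D` of `M * Mᵀ` is the Gram determinant of `M`. -/
lemma sum_principal_minors_mul_transpose {R : Type*} [CommRing R] {n D : ℕ}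
    (M : Matrix (Fin n) (Fin D) R) :
    ∑ I ∈ Finset.powersetCard D Finset.univ,
      ((M * M.transpose).submatrix (Subtype.val : I → Fin n) Subtype.val).det =
      (M.transpose * M).det := by
  have h := Matrix.coeff_det_one_add_X_smul_eq_sum_minors (M.transpose * M) D
  rw [← Matrix.coeff_det_one_add_X_smul_eq_sum_minors, Matrix.map_mul, ← Matrix.smul_mul,
    Matrix.det_one_add_mul_comm, Matrix.mul_smul, ← Matrix.map_mul, h]
  have : Finset.powersetCard D (Finset.univ : Finset (Fin D)) = {Finset.univ} := by
    simpa using Finset.powersetCard_self (Finset.univ : Finset (Fin D))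
  rw [this, Finset.sum_singleton]
  exact Matrix.det_submatrix_equiv_self (Equiv.subtypeUnivEquiv fun x => Finset.mem_univ x) _

lemma sum_symPoly_mulVec_add {n D : ℕ} (M : Matrix (Fin n) (Fin D) (ZMod 2))
    (b : Fin n → ZMod 2) :
    ∑ u, symPoly n D (M.mulVec u + b) = (M.transpose * M).det := by
  rw [← sum_principal_minors_mul_transpose]
  simp only [symPoly]
  rw [Finset.sum_comm]
  refine Finset.sum_congr rfl fun I hI => ?_
  have hc : I.card = D := (Finset.mem_powersetCard.1 hI).2
  let e : Fin D ≃ I := (finCongr hc.symm).trans I.equivFin.symm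
  let A : Matrix (Fin D) (Fin D) (ZMod 2) := M.submatrix (fun i => (e i : Fin n)) id
  have h1 : ∀ u, ∏ i ∈ I, (M.mulVec u + b) i = ∏ i, (A.mulVec u + fun i => b (e i)) i := by
    intro u
    rw [← Finset.prod_coe_sort, ← e.prod_comp]
    rfl
  simp only [h1]
  rw [sum_prod_mulVec_add_eq_det, ← Matrix.det_submatrix_equiv_self e]
  have h2 : ((M * M.transpose).submatrix (Subtype.val : I → Fin n) Subtype.val).submatrix e e =
      A * A.transpose := by
    ext i j
    simp [A, Matrix.mul_apply]
  rw [h2, Matrix.det_mul, Matrix.det_transpose]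
  generalize A.det = a
  revert a; decide

lemma degLE_of_sum_eq_zero {d : ℕ} {g : (Fin (d + 1) → ZMod 2) → ZMod 2} (hg : ∑ u, g u = 0) :
    degLE (d + 1) d g := by
  refine ⟨∑ c, MvPolynomial.C (g c) * ∑ t ∈ Finset.univ.powerset.erase Finset.univ,
    (∏ i ∈ t, MvPolynomial.X i) * ∏ i ∈ Finset.univ \ t, MvPolynomial.C (c i + 1), ?_, fun x => ?_⟩
  · refine MvPolynomial.totalDegree_finsetSum_le fun c _ => ?_
    refine (MvPolynomial.totalDegree_mul _ _).trans ?_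
    rw [MvPolynomial.totalDegree_C, zero_add]
    refine MvPolynomial.totalDegree_finsetSum_le fun t ht => ?_
    refine (MvPolynomial.totalDegree_mul _ _).trans ?_
    rw [← map_prod, MvPolynomial.totalDegree_C, add_zero]
    refine (MvPolynomial.totalDegree_finsetProd _ _).trans ?_
    simp only [MvPolynomial.totalDegree_X, Finset.sum_const, smul_eq_mul, mul_one]
    have := Finset.card_lt_univ_of_notMem (s := t)
      (Classical.choose_spec (not_forall.1 fun h =>
        (Finset.mem_erase.1 ht).1 (Finset.eq_univ_iff_forall.2 h)))
    rw [Fintype.card_fin] at this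
    omega
  · have h1 : ∀ c : Fin (d + 1) → ZMod 2, ∑ t ∈ Finset.univ.powerset.erase Finset.univ,
        (∏ i ∈ t, x i) * ∏ i ∈ Finset.univ \ t, (c i + 1) =
        (if c = x then 1 else 0) - ∏ i, x i := by
      intro c
      rw [Finset.sum_erase_eq_sub (by simp), ← Finset.prod_add]
      congr 1
      · split_ifs with hc
        · rw [hc]
          refine Finset.prod_eq_one fun i _ => ?_
          generalize x i = a
          revert a; decide
        · obtain ⟨i, hi⟩ := Function.ne_iff.1 hc
          refine Finset.prod_eq_zero (Finset.mem_univ i) ?_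
          generalize x i = a at hi
          generalize c i = b at hi
          revert a b; decide
      · simp
    simp only [map_sum, map_mul, map_prod, MvPolynomial.eval_C, MvPolynomial.eval_X, h1, mul_sub,
      Finset.sum_sub_distrib, ← Finset.sum_mul, hg]
    simp

/-- The block matrix `[[a, vᵀ], [v, G]]`. -/
def border {D : ℕ} (a : ZMod 2) (v : Fin D → ZMod 2) (G : Matrix (Fin D) (Fin D) (ZMod 2)) :
    Matrix (Fin (D + 1)) (Fin (D + 1)) (ZMod 2) :=
  Matrix.of (Fin.cons (Fin.cons a v) fun i => Fin.cons (v i) (G i))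

section border

variable {D : ℕ} (a : ZMod 2) (v : Fin D → ZMod 2) (G : Matrix (Fin D) (Fin D) (ZMod 2))

@[simp] lemma border_zero_zero : border a v G 0 0 = a := rfl
@[simp] lemma border_zero_succ (j : Fin D) : border a v G 0 j.succ = v j := rfl
@[simp] lemma border_succ_zero (i : Fin D) : border a v G i.succ 0 = v i := rfl
@[simp] lemma border_succ_succ (i j : Fin D) : border a v G i.succ j.succ = G i j := rfl

lemma det_border_eq_det_fromBlocks : (border a v G).det =
    (Matrix.fromBlocks G (Matrix.of fun i (_ : PUnit.{1}) => v i)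
      (Matrix.of fun (_ : PUnit.{1}) i => v i) (Matrix.of fun _ _ => a)).det := by
  let e : Fin (D + 1) ≃ Fin D ⊕ PUnit.{1} := (finSuccEquiv D).trans (Equiv.optionEquivSumPUnit _)
  rw [← Matrix.det_submatrix_equiv_self e.symm]
  congr 1
  ext (i | i) (j | j) <;> simp [e]

lemma det_border_one : (border 1 v G).det = (G - Matrix.vecMulVec v v).det := by
  rw [det_border_eq_det_fromBlocks]
  have : (Matrix.of fun (_ _ : PUnit.{1}) => (1 : ZMod 2)) = 1 := by
    ext i j; simp
  rw [this, Matrix.det_fromBlocks_one₂₂]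
  congr 2
  ext i j
  simp [Matrix.mul_apply, Matrix.vecMulVec_apply]

lemma det_border_mulVec_conj (P : Matrix (Fin D) (Fin D) (ZMod 2)) (hP : P.det = 1) :
    (border a (P.mulVec v) (P * G * P.transpose)).det = (border a v G).det := by
  rw [det_border_eq_det_fromBlocks, det_border_eq_det_fromBlocks]
  have h : Matrix.fromBlocks (P * G * P.transpose) (Matrix.of fun i (_ : PUnit.{1}) => P.mulVec v i)
      (Matrix.of fun (_ : PUnit.{1}) i => P.mulVec v i) (Matrix.of fun _ _ => a) =
      Matrix.fromBlocks P 0 0 1 * Matrix.fromBlocks G (Matrix.of fun i (_ : PUnit.{1}) => v i)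
      (Matrix.of fun (_ : PUnit.{1}) i => v i) (Matrix.of fun _ _ => a) *
      Matrix.fromBlocks P.transpose 0 0 1 := by
    rw [Matrix.fromBlocks_multiply, Matrix.fromBlocks_multiply]
    congr 1
    · simp
    · ext i j; simp [Matrix.mul_apply, Matrix.mulVec, dotProduct]
    · ext i j; simp [Matrix.mul_apply, Matrix.mulVec, dotProduct, mul_comm]
    · simp
  rw [h, Matrix.det_mul, Matrix.det_mul, Matrix.det_fromBlocks_zero₂₁, Matrix.det_fromBlocks_zero₂₁,
    Matrix.det_transpose, hP]
  simp

lemma det_border_zero_single_border (b : ZMod 2) :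
    (border 0 (Pi.single 0 1) (border b v G)).det = G.det := by
  rw [Matrix.det_succ_row_zero, Finset.sum_eq_single 1]
  · rw [Matrix.det_succ_column_zero, Finset.sum_eq_single 0]
    · have : (border 0 (Pi.single 0 1) (border b v G)) 0 (Fin.succ 0) = 1 := by
        rw [border_zero_succ, Pi.single_eq_same]
      have h2 : (border 0 (Pi.single 0 1) (border b v G)) (Fin.succ 0) 0 = 1 := by
        rw [border_succ_zero, Pi.single_eq_same]
      have h3 : ((((border 0 (Pi.single 0 1) (border b v G)).submatrix Fin.succ
        (Fin.succAbove 1))).submatrix (Fin.succAbove 0) Fin.succ) = G := by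
        ext i j
        simp only [Matrix.submatrix_apply, Fin.zero_succAbove]
        rw [show (1 : Fin (D + 2)) = Fin.succ 0 from rfl, Fin.succ_succAbove_succ]
        simp
      rw [h3, Matrix.submatrix_apply, Fin.succAbove_ne_zero_zero (by simp), h2,
        show (1 : Fin (D + 2)) = Fin.succ 0 from rfl, this, CharTwo.neg_eq]
      simp
    · intro i _ hi
      obtain ⟨i, rfl⟩ := Fin.exists_succ_eq.2 hi
      rw [Matrix.submatrix_apply, Fin.succAbove_ne_zero_zero (by simp)]
      simp
    · simp
  · intro j _ hj
    cases j using Fin.cases with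
    | zero => simp
    | succ j =>
      rw [border_zero_succ, Pi.single_eq_of_ne]
      · simp
      · rintro rfl; exact hj rfl
  · simp

lemma det_border_zero_zero : (border 0 0 G).det = 0 :=
  Matrix.det_eq_zero_of_row_eq_zero 0 fun j => by cases j using Fin.cases <;> simp

lemma exists_det_eq_one_mulVec_single_eq {v : Fin (D + 1) → ZMod 2} (hv : v ≠ 0) :
    ∃ P : Matrix (Fin (D + 1)) (Fin (D + 1)) (ZMod 2),
      P.det = 1 ∧ P.mulVec (Pi.single 0 1) = v := by
  obtain ⟨i, hi⟩ := Function.ne_iff.1 hv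
  have hi : v i = 1 := (ZMod.eq_zero_or_eq_one_of_two _).resolve_left hi
  refine ⟨((1 : Matrix _ _ (ZMod 2)).updateCol i v).submatrix id (Equiv.swap 0 i), ?_, ?_⟩
  · rw [Matrix.det_permute', ← Matrix.cramer_apply, Matrix.cramer_one]
    rcases Int.units_eq_one_or (Equiv.Perm.sign (Equiv.swap 0 i)) with h | h <;>
      simp [h, hi, CharTwo.neg_eq]
  · ext j
    simp

end border

/-- The set of symmetric `D × D` matrices over `𝔽₂`. -/
def symmMatrices (D : ℕ) : Finset (Matrix (Fin D) (Fin D) (ZMod 2)) :=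
  Finset.univ.filter Matrix.IsSymm

lemma mem_symmMatrices {D : ℕ} {G : Matrix (Fin D) (Fin D) (ZMod 2)} :
    G ∈ symmMatrices D ↔ G.IsSymm := by simp [symmMatrices]

lemma sum_symmMatrices_succ {D : ℕ} (φ : Matrix (Fin (D + 1)) (Fin (D + 1)) (ZMod 2) → ℕ) :
    ∑ G ∈ symmMatrices (D + 1), φ G =
      ∑ a, ∑ v, ∑ G ∈ symmMatrices D, φ (border a v G) := by
  simp_rw [← Finset.sum_product']
  refine Finset.sum_nbij' (fun G => (G 0 0, fun j => G 0 j.succ, G.submatrix Fin.succ Fin.succ))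
    (fun p => border p.1 p.2.1 p.2.2) ?_ ?_ ?_ ?_ ?_
  · intro G hG
    simp only [Finset.mem_product, Finset.mem_univ, true_and]
    exact mem_symmMatrices.2 ((mem_symmMatrices.1 hG).submatrix _)
  · rintro ⟨a, v, G⟩ h
    simp only [Finset.mem_product, Finset.mem_univ, true_and, mem_symmMatrices] at h ⊢
    ext i j
    rw [Matrix.transpose_apply]
    cases i using Fin.cases <;> cases j using Fin.cases <;> simp [h.apply]
  · intro G hG
    have h := mem_symmMatrices.1 hG
    ext i j
    cases i using Fin.cases <;> cases j using Fin.cases <;> simp [h.apply]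
  · rintro ⟨a, v, G⟩ h
    rfl
  · intro G hG
    congr 1
    have h := mem_symmMatrices.1 hG
    ext i j
    cases i using Fin.cases <;> cases j using Fin.cases <;> simp [h.apply]

/-- The number of nonsingular symmetric `D × D` matrices over `𝔽₂`. -/
def symmDetCount (D : ℕ) : ℕ := ∑ G ∈ symmMatrices D, G.det.val

lemma sum_det_border_one {D : ℕ} (v : Fin D → ZMod 2) :
    ∑ G ∈ symmMatrices D, (border 1 v G).det.val = symmDetCount D := by
  have hv : (Matrix.vecMulVec v v).IsSymm := by
    ext i j; simp [Matrix.vecMulVec_apply, mul_comm]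
  refine Finset.sum_nbij' (fun G => G - Matrix.vecMulVec v v) (fun G => G + Matrix.vecMulVec v v)
    ?_ ?_ ?_ ?_ ?_
  · exact fun G hG => mem_symmMatrices.2 ((mem_symmMatrices.1 hG).sub hv)
  · exact fun G hG => mem_symmMatrices.2 ((mem_symmMatrices.1 hG).add hv)
  · intro G _; simp
  · intro G _; simp
  · intro G _; rw [det_border_one]

lemma sum_det_border_zero {D : ℕ} {v : Fin (D + 1) → ZMod 2} (hv : v ≠ 0) :
    ∑ G ∈ symmMatrices (D + 1), (border 0 v G).det.val = 2 ^ (D + 1) * symmDetCount D := by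
  obtain ⟨P, hP, rfl⟩ := exists_det_eq_one_mulVec_single_eq hv
  have hu : IsUnit P.det := by rw [hP]; exact isUnit_one
  have hut : IsUnit P.transpose.det := by rwa [Matrix.det_transpose]
  trans ∑ G ∈ symmMatrices (D + 1), (border 0 (Pi.single 0 1) G).det.val
  · have hsymm : ∀ (Q G : Matrix (Fin (D + 1)) (Fin (D + 1)) (ZMod 2)), G.IsSymm →
        (Q * G * Q.transpose).IsSymm := fun Q G hG => by
      rw [Matrix.IsSymm, Matrix.transpose_mul, Matrix.transpose_mul, hG.eq,
        Matrix.transpose_transpose, Matrix.mul_assoc]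
    have hleft : ∀ G, P * (P⁻¹ * G * P⁻¹.transpose) * P.transpose = G := fun G => by
      rw [Matrix.transpose_nonsing_inv, Matrix.mul_assoc, Matrix.mul_assoc,
        Matrix.nonsing_inv_mul _ hut, Matrix.mul_one, Matrix.mul_nonsing_inv_cancel_left _ _ hu]
    have hright : ∀ G, P⁻¹ * (P * G * P.transpose) * P⁻¹.transpose = G := fun G => by
      rw [Matrix.transpose_nonsing_inv, Matrix.mul_assoc, Matrix.mul_assoc,
        Matrix.mul_nonsing_inv _ hut, Matrix.mul_one, Matrix.nonsing_inv_mul_cancel_left _ _ hu]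
    refine Finset.sum_nbij' (fun G => P⁻¹ * G * P⁻¹.transpose) (fun G => P * G * P.transpose)
      ?_ ?_ ?_ ?_ ?_
    · exact fun G hG => mem_symmMatrices.2 (hsymm _ _ (mem_symmMatrices.1 hG))
    · exact fun G hG => mem_symmMatrices.2 (hsymm _ _ (mem_symmMatrices.1 hG))
    · exact fun G _ => hleft G
    · exact fun G _ => hright G
    · intro G _
      rw [← det_border_mulVec_conj _ _ (P⁻¹ * G * P⁻¹.transpose) P hP, hleft]
  · rw [sum_symmMatrices_succ]
    simp only [det_border_zero_single_border]
    simp [symmDetCount, ZMod.card, pow_succ]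
    ring

lemma symmDetCount_add_two (D : ℕ) : symmDetCount (D + 2) =
    2 ^ (D + 1) * symmDetCount (D + 1) + (2 ^ (D + 1) - 1) * (2 ^ (D + 1) * symmDetCount D) := by
  rw [symmDetCount, sum_symmMatrices_succ]
  rw [show (Finset.univ : Finset (ZMod 2)) = {1, 0} by decide, Finset.sum_pair (by decide)]
  congr 1
  · simp only [sum_det_border_one]
    simp [ZMod.card]
  · rw [← Finset.add_sum_erase _ _ (Finset.mem_univ (0 : Fin (D + 1) → ZMod 2)),
      Finset.sum_congr rfl fun v hv => sum_det_border_zero (Finset.mem_erase.1 hv).1]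
    simp [det_border_zero_zero, Finset.card_erase_of_mem, ZMod.card]

/-- The number of symmetric `D × D` matrices over `𝔽₂`. -/
def symmCount : ℕ → ℕ
  | 0 => 1
  | D + 1 => 2 ^ (D + 1) * symmCount D

lemma symmDetCount_zero : symmDetCount 0 = 1 := by
  have : symmMatrices 0 = {1} := by
    ext G
    simp only [mem_symmMatrices, Finset.mem_singleton]
    exact ⟨fun _ => Subsingleton.elim _ _, fun h => by rw [h]; exact Matrix.isSymm_one⟩
  simp [symmDetCount, this, ZMod.val_one]

lemma symmDetCount_one : symmDetCount 1 = 1 := by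
  rw [symmDetCount, sum_symmMatrices_succ]
  rw [show (Finset.univ : Finset (ZMod 2)) = {1, 0} by decide, Finset.sum_pair (by decide)]
  simp only [sum_det_border_one, symmDetCount_zero]
  simp

lemma sixteen_mul_symmDetCount_le (D : ℕ) :
    16 * symmDetCount (D + 3) ≤ 7 * symmCount (D + 3) ∧
    16 * symmDetCount (D + 4) ≤ 7 * symmCount (D + 4) := by
  induction D with
  | zero =>
    simp [symmDetCount_add_two, symmDetCount_one, symmDetCount_zero, symmCount]
  | succ D ih =>
    refine ⟨ih.2, ?_⟩
    obtain ⟨h1, h2⟩ := ih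
    have h3 : symmCount (D + 5) = 2 ^ (D + 5) * symmCount (D + 4) := rfl
    have h4 : symmCount (D + 4) = 2 ^ (D + 4) * symmCount (D + 3) := rfl
    have h5 := symmDetCount_add_two (D + 3)
    have h6 : (2 ^ (D + 3 + 1) - 1) * (2 ^ (D + 3 + 1) * symmDetCount (D + 3)) ≤
        2 ^ (D + 4) * (2 ^ (D + 4) * symmDetCount (D + 3)) :=
      Nat.mul_le_mul_right _ (Nat.sub_le _ _)
    calc 16 * symmDetCount (D + 5)
        ≤ 2 ^ (D + 4) * (16 * symmDetCount (D + 4)) +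
          2 ^ (D + 4) * (2 ^ (D + 4) * (16 * symmDetCount (D + 3))) := by
          rw [h5]; simp only [Nat.add_assoc, Nat.reduceAdd] at h6 ⊢; linarith
      _ ≤ 2 ^ (D + 4) * (7 * symmCount (D + 4)) +
          2 ^ (D + 4) * (2 ^ (D + 4) * (7 * symmCount (D + 3))) := by gcongr
      _ = 7 * symmCount (D + 5) := by rw [h3, h4]; ring

lemma card_fiber_mul_card {A B : Type*} [AddCommGroup A] [AddCommGroup B] [Fintype A] [Fintype B]
    [Module (ZMod 2) A] [Module (ZMod 2) B] (f : A →ₗ[ZMod 2] B) (hf : Function.Surjective f)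
    (y : B) : (Finset.univ.filter fun x => f x = y).card * Fintype.card B = Fintype.card A := by
  have hz : ∀ z, (Finset.univ.filter fun x => f x = z).card =
      (Finset.univ.filter fun x => f x = y).card := fun z => by
    convert AddMonoidHom.card_fiber_eq_of_mem_range f.toAddMonoidHom (hf z) (hf y) <;> rfl
  have h := Finset.card_eq_sum_card_fiberwise (f := f) (s := Finset.univ) (t := Finset.univ)
    (by simp)
  rw [Finset.card_univ, Finset.sum_congr rfl fun z _ => hz z, Finset.sum_const, smul_eq_mul,
    Finset.card_univ] at h
  rw [h, mul_comm]

/-- The matrix whose rows are the all-ones vector and the vectors `c j`. -/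
def augRows {n D : ℕ} (c : Fin D → Fin n → ZMod 2) : Matrix (Option (Fin D)) (Fin n) (ZMod 2) :=
  Matrix.of fun j => j.elim 1 c

lemma augRows_mulVec_none {n D : ℕ} (c : Fin D → Fin n → ZMod 2) (x : Fin n → ZMod 2) :
    (augRows c).mulVec x none = x ⬝ᵥ x := by
  simp only [Matrix.mulVec, augRows, Matrix.of_apply, dotProduct]
  refine Finset.sum_congr rfl fun i _ => ?_
  rcases ZMod.eq_zero_or_eq_one_of_two (x i) with h | h <;> simp [h]

lemma augRows_mulVec_some {n D : ℕ} (c : Fin D → Fin n → ZMod 2) (x : Fin n → ZMod 2)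
    (j : Fin D) : (augRows c).mulVec x (some j) = c j ⬝ᵥ x := rfl

/-- The vectors `c j` together with the all-ones vector are linearly independent. -/
def augIndep {n D : ℕ} (c : Fin D → Fin n → ZMod 2) : Prop :=
  Function.Surjective (augRows c).mulVec

lemma augIndep.tail {n D : ℕ} {c₀ : Fin n → ZMod 2} {c : Fin D → Fin n → ZMod 2}
    (h : augIndep (Fin.cons c₀ c : Fin (D + 1) → Fin n → ZMod 2)) : augIndep c := by
  intro y
  obtain ⟨x, hx⟩ := h fun j => j.elim (y none) (Fin.cons 0 fun i => y (some i))
  refine ⟨x, funext fun j => ?_⟩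
  cases j with
  | none => simpa [augRows_mulVec_none] using congrFun hx none
  | some j => simpa [augRows_mulVec_some] using congrFun hx (some j.succ)

/-- The Gram matrix of the vectors `c j`. -/
def gram {n D : ℕ} (c : Fin D → Fin n → ZMod 2) : Matrix (Fin D) (Fin D) (ZMod 2) :=
  Matrix.of fun i j => c i ⬝ᵥ c j

lemma card_augIndep_gram_mul_le {n D : ℕ} (G : Matrix (Fin D) (Fin D) (ZMod 2)) :
    (Finset.univ.filter fun c : Fin D → Fin n → ZMod 2 => augIndep c ∧ gram c = G).card *
      symmCount D ≤ (2 ^ n) ^ D := by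
  induction D with
  | zero =>
    rw [symmCount, mul_one]
    exact (Finset.card_le_univ _).trans (by simp)
  | succ D ih =>
    set S := Finset.univ.filter fun c : Fin D → Fin n → ZMod 2 =>
      augIndep c ∧ gram c = G.submatrix Fin.succ Fin.succ with hS
    have hfib : ∀ c ∈ S, (Finset.univ.filter fun x : Fin n → ZMod 2 =>
        (augRows c).mulVecLin x = fun j => j.elim (G 0 0) fun i => G i.succ 0).card * 2 ^ (D + 1)
        = 2 ^ n := fun c hc => by
      have := card_fiber_mul_card (augRows c).mulVecLin (Finset.mem_filter.1 hc).2.1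
        (fun j => j.elim (G 0 0) fun i => G i.succ 0)
      simp only [Fintype.card_fun, ZMod.card, Fintype.card_option, Fintype.card_fin] at this
      convert this
    have hle : (Finset.univ.filter fun c : Fin (D + 1) → Fin n → ZMod 2 =>
        augIndep c ∧ gram c = G).card ≤ ∑ c ∈ S, (Finset.univ.filter fun x : Fin n → ZMod 2 =>
        (augRows c).mulVecLin x = fun j => j.elim (G 0 0) fun i => G i.succ 0).card := by
      rw [← Finset.card_sigma]
      refine Finset.card_le_card_of_injOn (fun c => ⟨Fin.tail c, c 0⟩) ?_ ?_
      · intro c hc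
        obtain ⟨hc1, hc2⟩ := (Finset.mem_filter.1 hc).2
        rw [← Fin.cons_self_tail c] at hc1
        simp only [Finset.coe_sigma, Set.mem_sigma_iff, Finset.mem_coe, hS, Finset.mem_filter,
          Finset.mem_univ, true_and]
        refine ⟨⟨hc1.tail, ?_⟩, ?_⟩
        · rw [← hc2]; rfl
        · funext j
          rw [← hc2]
          cases j with
          | none => exact augRows_mulVec_none _ _
          | some j => rfl
      · intro c _ c' _ h
        simp only [Sigma.mk.injEq, heq_eq_eq] at h
        rw [← Fin.cons_self_tail c, ← Fin.cons_self_tail c', h.1, h.2]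
    calc _ ≤ (∑ c ∈ S, (Finset.univ.filter fun x : Fin n → ZMod 2 =>
        (augRows c).mulVecLin x = fun j => j.elim (G 0 0) fun i => G i.succ 0).card) *
          symmCount (D + 1) := Nat.mul_le_mul_right _ hle
      _ = (S.card * symmCount D) * 2 ^ n := by
        rw [symmCount, ← mul_assoc, Finset.sum_mul, Finset.sum_congr rfl hfib, Finset.sum_const,
          smul_eq_mul]
        ring
      _ ≤ (2 ^ n) ^ D * 2 ^ n := Nat.mul_le_mul_right _ (ih _)
      _ = _ := (pow_succ _ _).symm

lemma card_augIndep_det_gram_mul_le (n D : ℕ) :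
    (Finset.univ.filter fun c : Fin D → Fin n → ZMod 2 => augIndep c ∧ (gram c).det = 1).card *
      symmCount D ≤ symmDetCount D * (2 ^ n) ^ D := by
  have hsymm : ∀ c : Fin D → Fin n → ZMod 2, (gram c).IsSymm := fun c => by
    ext i j; exact dotProduct_comm (c j) (c i)
  have hN : symmDetCount D = ((symmMatrices D).filter fun G => G.det = 1).card := by
    rw [symmDetCount, Finset.card_filter]
    refine Finset.sum_congr rfl fun G _ => ?_
    rcases ZMod.eq_zero_or_eq_one_of_two G.det with h | h <;> simp [h, ZMod.val_one]
  rw [Finset.card_eq_sum_card_fiberwise (f := gram)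
    (t := (symmMatrices D).filter fun G => G.det = 1), Finset.sum_mul, hN, ← smul_eq_mul,
    ← Finset.sum_const]
  · refine Finset.sum_le_sum fun G _ => le_trans (Nat.mul_le_mul_right _ ?_)
      (card_augIndep_gram_mul_le G)
    refine Finset.card_le_card fun c hc => ?_
    simp only [Finset.mem_filter, Finset.mem_univ, true_and] at hc ⊢
    exact ⟨hc.1.1, hc.2⟩
  · intro c hc
    have := (Finset.mem_filter.1 hc).2
    simp only [Finset.coe_filter, Set.mem_ofPred_eq, mem_symmMatrices]
    exact ⟨hsymm c, this.2⟩

lemma exists_relation_of_not_augIndep {n D : ℕ} {c : Fin D → Fin n → ZMod 2}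
    (h : ¬ augIndep c) : ∃ w : Option (Fin D) → ZMod 2, w ≠ 0 ∧
      ∑ j, w (some j) • c j = fun _ => w none := by
  have hlt : LinearMap.range (augRows c).mulVecLin < ⊤ :=
    lt_top_iff_ne_top.2 fun h' => h (LinearMap.range_eq_top.1 h')
  obtain ⟨f, hf, hle⟩ := Submodule.exists_le_ker_of_lt_top _ hlt
  refine ⟨fun j => f (Pi.single j 1), fun h0 => hf ?_, ?_⟩
  · exact LinearMap.pi_ext' fun j => LinearMap.ext_ring (congrFun h0 j)
  · funext i
    have h1 : f ((augRows c).mulVec (Pi.single i 1)) = 0 := hle ⟨_, rfl⟩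
    rw [LinearMap.pi_apply_eq_sum_univ f, Fintype.sum_option] at h1
    have h2 : ∀ j : Option (Fin D), (fun k => if j = k then (1 : ZMod 2) else 0) = Pi.single j 1 :=
      fun j => by ext k; simp [Pi.single_apply, eq_comm]
    simp only [h2] at h1
    have h3 := CharTwo.add_eq_zero.1 h1
    simp [augRows] at h3
    simp only [Finset.sum_apply, Pi.smul_apply, smul_eq_mul]
    rw [h3]
    exact Finset.sum_congr rfl fun j _ => mul_comm _ _

lemma card_not_augIndep_mul_le {n : ℕ} (hn : 0 < n) (D : ℕ) :
    (Finset.univ.filter fun c : Fin D → Fin n → ZMod 2 => ¬ augIndep c).card * 2 ^ n ≤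
      2 ^ (D + 1) * (2 ^ n) ^ D := by
  have hone : ∀ w : Option (Fin D) → ZMod 2, w ≠ 0 →
      (Finset.univ.filter fun c : Fin D → Fin n → ZMod 2 =>
        ∑ j, w (some j) • c j = fun _ => w none).card * 2 ^ n ≤ (2 ^ n) ^ D := by
    intro w hw
    by_cases hw' : ∃ j, w (some j) ≠ 0
    · obtain ⟨j, hj⟩ := hw'
      have := card_fiber_mul_card
        (∑ j, w (some j) • (LinearMap.proj j : (Fin D → Fin n → ZMod 2) →ₗ[ZMod 2] _))
        (fun y => ⟨Pi.single j ((w (some j))⁻¹ • y), by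
          rw [LinearMap.sum_apply, Finset.sum_eq_single j]
          · simp [hj]
          · intro k _ hk
            simp [hk]
          · simp⟩) (fun _ => w none)
      simp only [LinearMap.sum_apply, LinearMap.smul_apply, LinearMap.proj_apply] at this
      simpa [ZMod.card] using this.le
    · push Not at hw'
      rw [Finset.filter_false_of_mem, Finset.card_empty, zero_mul]
      · exact Nat.zero_le _
      · intro c _ h
        apply hw
        funext j
        cases j with
        | none => simpa [hw'] using (congrFun h ⟨0, hn⟩).symm
        | some j => exact hw' j
  have hsub : (Finset.univ.filter fun c : Fin D → Fin n → ZMod 2 => ¬ augIndep c) ⊆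
      (Finset.univ.filter fun w : Option (Fin D) → ZMod 2 => w ≠ 0).biUnion fun w =>
        Finset.univ.filter fun c => ∑ j, w (some j) • c j = fun _ => w none := by
    intro c hc
    obtain ⟨w, hw, h⟩ := exists_relation_of_not_augIndep (Finset.mem_filter.1 hc).2
    simp only [Finset.mem_biUnion, Finset.mem_filter, Finset.mem_univ, true_and]
    exact ⟨w, hw, h⟩
  calc _ ≤ (∑ w ∈ Finset.univ.filter fun w : Option (Fin D) → ZMod 2 => w ≠ 0,
        (Finset.univ.filter fun c : Fin D → Fin n → ZMod 2 =>
          ∑ j, w (some j) • c j = fun _ => w none).card) * 2 ^ n :=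
        Nat.mul_le_mul_right _ ((Finset.card_le_card hsub).trans Finset.card_biUnion_le)
    _ ≤ ∑ w ∈ Finset.univ.filter fun w : Option (Fin D) → ZMod 2 => w ≠ 0, (2 ^ n) ^ D := by
        rw [Finset.sum_mul]
        exact Finset.sum_le_sum fun w hw => hone w (Finset.mem_filter.1 hw).2
    _ ≤ ∑ w : Option (Fin D) → ZMod 2, (2 ^ n) ^ D :=
        Finset.sum_le_sum_of_subset (Finset.filter_subset _ _)
    _ = _ := by simp [ZMod.card]

lemma augIndep.injective_mulVec {n D : ℕ} {c : Fin D → Fin n → ZMod 2} (h : augIndep c) :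
    Function.Injective (Matrix.of c).transpose.mulVec := by
  intro u u' huu
  funext k
  obtain ⟨x, hx⟩ := h (Pi.single (some k) 1)
  have hx' : (Matrix.of c).mulVec x = Pi.single k 1 := by
    funext j
    have := congrFun hx (some j)
    rw [augRows_mulVec_some] at this
    change c j ⬝ᵥ x = _
    simpa [Pi.single_apply] using this
  have key : ∀ u, x ⬝ᵥ (Matrix.of c).transpose.mulVec u = u k := fun u => by
    rw [Matrix.mulVec_transpose, dotProduct_comm, ← Matrix.dotProduct_mulVec, hx']
    simp
  rw [← key u, ← key u', huu]

lemma symmCount_pos (D : ℕ) : 0 < symmCount D := by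
  induction D with
  | zero => simp [symmCount]
  | succ D ih => rw [symmCount]; positivity

lemma sixteen_mul_card_augIndep_det_gram_le (n : ℕ) {D : ℕ} (hD : 3 ≤ D) :
    16 * (Finset.univ.filter fun c : Fin D → Fin n → ZMod 2 =>
      augIndep c ∧ (gram c).det = 1).card ≤ 7 * (2 ^ n) ^ D := by
  obtain ⟨k, rfl⟩ := Nat.exists_eq_add_of_le' hD
  refine Nat.le_of_mul_le_mul_right ?_ (symmCount_pos (k + 3))
  calc _ = 16 * (_ * symmCount (k + 3)) := mul_assoc _ _ _
    _ ≤ 16 * (symmDetCount (k + 3) * (2 ^ n) ^ (k + 3)) :=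
      Nat.mul_le_mul_left _ (card_augIndep_det_gram_mul_le n (k + 3))
    _ = 16 * symmDetCount (k + 3) * (2 ^ n) ^ (k + 3) := (mul_assoc _ _ _).symm
    _ ≤ 7 * symmCount (k + 3) * (2 ^ n) ^ (k + 3) :=
      Nat.mul_le_mul_right _ (sixteen_mul_symmDetCount_le k).1
    _ = _ := by ring

lemma det_transpose_mul_eq_one_of_not_degLE {n d : ℕ} {M : Matrix (Fin n) (Fin (d + 1)) (ZMod 2)}
    {b : Fin n → ZMod 2}
    (h : ¬ degLE (d + 1) d fun u => symPoly n (d + 1) (M.mulVec u + b)) :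
    (M.transpose * M).det = 1 := by
  refine (ZMod.eq_zero_or_eq_one_of_two _).resolve_left fun h0 => h (degLE_of_sum_eq_zero ?_)
  rw [sum_symPoly_mulVec_add, h0]

lemma Rej_symPoly_le {n d : ℕ} (hd : 2 ≤ d) (hn : d + 7 ≤ n) :
    Rej n d (d + 1) (symPoly n (d + 1)) ≤ 63 / 128 := by
  set D := d + 1 with hD
  set good := Finset.univ.filter fun c : Fin D → Fin n → ZMod 2 => augIndep c with hgood
  set bad := Finset.univ.filter fun c : Fin D → Fin n → ZMod 2 => ¬ augIndep c with hbad
  set one := Finset.univ.filter fun c : Fin D → Fin n → ZMod 2 =>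
    augIndep c ∧ (gram c).det = 1 with hone
  have hnum : (Finset.univ.filter fun Mb : Matrix (Fin n) (Fin D) (ZMod 2) × (Fin n → ZMod 2) =>
      Function.Injective Mb.1.mulVec ∧
        ¬ degLE D d (fun u => symPoly n D (Mb.1.mulVec u + Mb.2))).card ≤
      (one.card + bad.card) * 2 ^ n := by
    calc _ ≤ ((one ∪ bad) ×ˢ (Finset.univ : Finset (Fin n → ZMod 2))).card := by
          refine Finset.card_le_card_of_injOn (fun Mb => (fun j i => Mb.1 i j, Mb.2)) ?_ ?_
          · intro Mb hMb
            have hdet := det_transpose_mul_eq_one_of_not_degLE (Finset.mem_filter.1 hMb).2.2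
            simp only [Finset.coe_product, Set.mem_prod, Finset.mem_coe, Finset.mem_union,
              Finset.mem_univ, and_true, hone, hbad, Finset.mem_filter, true_and]
            by_cases hc : augIndep fun j i => Mb.1 i j
            · exact Or.inl ⟨hc, hdet⟩
            · exact Or.inr hc
          · intro M _ M' _ h
            simp only [Prod.mk.injEq] at h
            exact Prod.ext (Matrix.ext fun i j => congrFun (congrFun h.1 j) i) h.2
      _ ≤ _ := by
          rw [Finset.card_product]
          refine Nat.mul_le_mul (Finset.card_union_le _ _) (by simp [ZMod.card])
  have hden : good.card * 2 ^ n ≤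
      (Finset.univ.filter fun Mb : Matrix (Fin n) (Fin D) (ZMod 2) × (Fin n → ZMod 2) =>
        Function.Injective Mb.1.mulVec).card := by
    calc _ = (good ×ˢ (Finset.univ : Finset (Fin n → ZMod 2))).card := by
          simp [Finset.card_product, ZMod.card]
      _ ≤ _ := by
          refine Finset.card_le_card_of_injOn
            (fun cb => ((Matrix.of cb.1).transpose, cb.2)) ?_ ?_
          · intro cb hcb
            simp only [Finset.coe_product, Set.mem_prod, Finset.mem_coe, hgood, Finset.mem_filter,
              Finset.mem_univ, true_and, and_true] at hcb
            simpa using hcb.injective_mulVec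
          · intro c _ c' _ h
            simp only [Prod.mk.injEq] at h
            exact Prod.ext (Matrix.transpose_injective h.1) h.2
  have hsum : good.card + bad.card = (2 ^ n) ^ D := by
    rw [hgood, hbad, Finset.card_filter_add_card_filter_not]
    simp [ZMod.card]
  have h1 : 16 * one.card ≤ 7 * (2 ^ n) ^ D :=
    sixteen_mul_card_augIndep_det_gram_le n (by omega)
  have h2 : 32 * bad.card ≤ (2 ^ n) ^ D := by
    refine Nat.le_of_mul_le_mul_left ?_ (show 0 < 2 ^ (D + 1) by positivity)
    calc 2 ^ (D + 1) * (32 * bad.card) = bad.card * 2 ^ (D + 6) := by ring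
      _ ≤ bad.card * 2 ^ n := Nat.mul_le_mul_left _ (Nat.pow_le_pow_right (by norm_num) hn)
      _ ≤ _ := card_not_augIndep_mul_le (by omega) D
  have hX : 0 < (2 ^ n) ^ D := by positivity
  have hgpos : 0 < good.card * 2 ^ n := Nat.mul_pos (by omega) (by positivity)
  have hmain : 128 * ((one.card + bad.card) * 2 ^ n) ≤ 63 * (good.card * 2 ^ n) := by
    rw [← mul_assoc, ← mul_assoc]
    exact Nat.mul_le_mul_right _ (by omega)
  rw [Rej, div_le_div_iff₀ (by exact_mod_cast hgpos.trans_le hden) (by norm_num)]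
  have hfin := (Nat.mul_le_mul_left 128 hnum).trans (hmain.trans (Nat.mul_le_mul_left 63 hden))
  rw [mul_comm]
  exact_mod_cast hfin

theorem statement14 (s d : ℕ) (hs : 2 ≤ s) (hd : d + 1 = 2 ^ s) :
    ∀ ε : ℝ, 0 < ε → ∃ n₀ : ℕ, ∀ n : ℕ, n₀ ≤ n →
      1/2 - ε ≤ deltaD n d (symPoly n (d+1)) ∧
      Rej n d (d+1) (symPoly n (d+1)) ≤ 1/2 - (2:ℝ) ^ (-7 : ℤ) + ε := by
  intro ε hε
  obtain ⟨n₀, hn₀⟩ := exists_forall_le_deltaD_symPoly s d hd ε hε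
  have hs4 : 2 ^ 2 ≤ 2 ^ s := Nat.pow_le_pow_right (by norm_num) hs
  refine ⟨max n₀ (d + 7), fun n hn => ⟨hn₀ n (le_of_max_le_left hn), ?_⟩⟩
  have h := Rej_symPoly_le (by omega) (le_of_max_le_right hn)
  norm_num
  linarith

end
end
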